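/- arXiv:2402.11613 — 3 statements merged into one kernel-verified Lean document; each statement's English description precedes it below -/
import Mathlib

section
/- If A is a left d-Gorenstein ring with d ≥ 1, then Ā = A/(ω) is left (d−1)-Gorenstein. -/
/-!
STATEMENT 6: Let `ω ∈ A` be regular and normal and `Ā = A/(ω)` (realized by a
surjective ring homomorphism `π : A → B` with kernel `Aω`).  If `A` is left
`d`-Gorenstein (every left `A`-module has Gorenstein projective dimension `≤ d`)
with `d ≥ 1`, then `B` is left `(d - 1)`-Gorenstein.
-/

universe u v

/-- A `ℤ`-indexed cochain complex of `A`-modules (the differential conditions are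
imposed in `IsTotallyAcyclic`). -/
structure ProjCx (A : Type u) [Ring A] : Type (max u (v + 1)) where
  X : ℤ → ModuleCat.{v} A
  d : ∀ i, X i →ₗ[A] X (i + 1)

/-- The complex consists of projective modules, is acyclic, and stays acyclic after
applying `Hom_A(-, Q)` for every projective `A`-module `Q`. -/
def IsTotallyAcyclic {A : Type u} [Ring A] (C : ProjCx.{u, v} A) : Prop :=
  (∀ i, Module.Projective A (C.X i)) ∧
  (∀ i, LinearMap.range (C.d i) = LinearMap.ker (C.d (i + 1))) ∧
  (∀ (Q : Type v) [AddCommGroup Q] [Module A Q], Module.Projective A Q →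
    ∀ (i : ℤ) (g : C.X (i + 1) →ₗ[A] Q), g ∘ₗ C.d i = 0 →
      ∃ h : C.X (i + 1 + 1) →ₗ[A] Q, h ∘ₗ C.d (i + 1) = g)

/-- `L` is a Gorenstein projective `A`-module: it is a cocycle of a totally acyclic
complex of projective `A`-modules. -/
def IsGorensteinProjective (A : Type u) [Ring A]
    (L : Type v) [AddCommGroup L] [Module A L] : Prop :=
  ∃ C : ProjCx.{u, v} A, IsTotallyAcyclic C ∧ Nonempty (L ≃ₗ[A] LinearMap.ker (C.d 0))

/-- `GpdLE A n L` : the Gorenstein projective dimension of `L` over `A` is at most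
`n`, i.e. there is an exact sequence `0 → Gⁿ → ⋯ → G⁰ → L → 0` with all `Gⁱ`
Gorenstein projective (expressed by repeatedly taking kernels of surjections from
Gorenstein projective modules). -/
def GpdLE (A : Type u) [Ring A] : ℕ → ModuleCat.{v} A → Prop
  | 0, L => IsGorensteinProjective A L
  | n + 1, L => ∃ (G : ModuleCat.{v} A) (f : G →ₗ[A] L),
      IsGorensteinProjective A G ∧ Function.Surjective f ∧
        GpdLE A n (ModuleCat.of A (LinearMap.ker f))


namespace GorQuot

open CategoryTheory CategoryTheory.Abelian

section Basics

variable {A : Type u} [Ring A]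

/-- short exact sequences of modules, concretely -/
def SES {X Y Z : ModuleCat.{v} A} (f : X →ₗ[A] Y) (g : Y →ₗ[A] Z) : Prop :=
  Function.Injective f ∧ (∀ y, g y = 0 ↔ ∃ x, f x = y) ∧ Function.Surjective g

/-- vanishing of a given Ext group -/
def EV (M Q : ModuleCat.{v} A) (n : ℕ) : Prop :=
  letI : HasExt.{max u (v + 1)} (ModuleCat.{v} A) := HasExt.standard _
  ∀ x : Ext M Q n, x = 0

lemma SES.short {X Y Z : ModuleCat.{v} A} {f : X →ₗ[A] Y} {g : Y →ₗ[A] Z} (h : SES f g) :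
    ∃ w : ModuleCat.ofHom f ≫ ModuleCat.ofHom g = 0,
      (ShortComplex.mk (ModuleCat.ofHom f) (ModuleCat.ofHom g) w).ShortExact := by
  obtain ⟨h1, h2, h3⟩ := h
  have w : ModuleCat.ofHom f ≫ ModuleCat.ofHom g = 0 := by
    ext x
    exact (h2 _).2 ⟨x, rfl⟩
  refine ⟨w, ?_⟩
  have e1 : Mono (ModuleCat.ofHom f) := (ModuleCat.mono_iff_injective _).2 h1
  have e2 : Epi (ModuleCat.ofHom g) := (ModuleCat.epi_iff_surjective _).2 h3
  refine ShortComplex.ShortExact.mk' ?_ e1 e2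
  rw [ShortComplex.moduleCat_exact_iff]
  intro y hy
  exact (h2 y).1 hy

variable {X Y Z Q : ModuleCat.{v} A} {f : X →ₗ[A] Y} {g : Y →ₗ[A] Z}

lemma EV.mid (h : SES f g) {n : ℕ} (h1 : EV X Q n) (h3 : EV Z Q n) : EV Y Q n := by
  let _ : HasExt.{max u (v + 1)} (ModuleCat.{v} A) := HasExt.standard _
  obtain ⟨w, hS⟩ := h.short
  intro x
  obtain ⟨y, hy⟩ := Ext.contravariant_sequence_exact₂ hS Q x (h1 _)
  rw [← hy, h3 y, Ext.comp_zero]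

lemma EV.left (h : SES f g) {n : ℕ} (h2 : EV Y Q n) (h3 : EV Z Q (n + 1)) : EV X Q n := by
  let _ : HasExt.{max u (v + 1)} (ModuleCat.{v} A) := HasExt.standard _
  obtain ⟨w, hS⟩ := h.short
  intro x
  obtain ⟨y, hy⟩ := Ext.contravariant_sequence_exact₁ hS Q x (add_comm 1 n) (h3 _)
  rw [← hy, h2 y, Ext.comp_zero]

lemma EV.right (h : SES f g) {n : ℕ} (h1 : EV X Q n) (h2 : EV Y Q (n + 1)) : EV Z Q (n + 1) := by
  let _ : HasExt.{max u (v + 1)} (ModuleCat.{v} A) := HasExt.standard _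
  obtain ⟨w, hS⟩ := h.short
  intro x
  obtain ⟨y, hy⟩ := Ext.contravariant_sequence_exact₃ hS Q x (h2 _) (add_comm 1 n)
  rw [← hy, h1 y, Ext.comp_zero]

lemma EV.extend (h : SES f g) (h3 : EV Z Q 1) (φ : X →ₗ[A] Q) : ∃ ψ : Y →ₗ[A] Q, ∀ x, ψ (f x) = φ x := by
  let _ : HasExt.{max u (v + 1)} (ModuleCat.{v} A) := HasExt.standard _
  obtain ⟨w, hS⟩ := h.short
  obtain ⟨y, hy⟩ := Ext.contravariant_sequence_exact₁ hS Q (Ext.mk₀ (ModuleCat.ofHom φ))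
    (add_zero 1) (h3 _)
  obtain ⟨y, rfl⟩ := (Ext.mk₀_bijective _ _).2 y
  rw [Ext.mk₀_comp_mk₀] at hy
  have := (Ext.mk₀_bijective _ _).1 hy
  refine ⟨y.hom, fun x => ?_⟩
  have := congrArg (fun t => t.hom x) this
  simpa using this

lemma EV.of_extend (h : SES f g) (h2 : EV Y Q 1)
    (hφ : ∀ φ : X →ₗ[A] Q, ∃ ψ : Y →ₗ[A] Q, ∀ x, ψ (f x) = φ x) : EV Z Q 1 := by
  let _ : HasExt.{max u (v + 1)} (ModuleCat.{v} A) := HasExt.standard _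
  obtain ⟨w, hS⟩ := h.short
  intro x
  obtain ⟨y, hy⟩ := Ext.contravariant_sequence_exact₃ hS Q x (h2 _) (add_zero 1)
  obtain ⟨y, rfl⟩ := (Ext.mk₀_bijective _ _).2 y
  obtain ⟨ψ, hψ⟩ := hφ y.hom
  have : y = ModuleCat.ofHom f ≫ ModuleCat.ofHom ψ := by
    ext x
    simpa using (hψ x).symm
  rw [← hy, this, ← Ext.mk₀_comp_mk₀]
  exact hS.extClass_comp_assoc _

lemma EV.lift (h : SES f g) (h1 : EV Q X 1) (φ : Q →ₗ[A] Z) : ∃ ψ : Q →ₗ[A] Y, ∀ x, g (ψ x) = φ x := by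
  let _ : HasExt.{max u (v + 1)} (ModuleCat.{v} A) := HasExt.standard _
  obtain ⟨w, hS⟩ := h.short
  obtain ⟨y, hy⟩ := Ext.covariant_sequence_exact₃ Q hS (Ext.mk₀ (ModuleCat.ofHom φ))
    (zero_add 1) (h1 _)
  obtain ⟨y, rfl⟩ := (Ext.mk₀_bijective _ _).2 y
  rw [Ext.mk₀_comp_mk₀] at hy
  have := (Ext.mk₀_bijective _ _).1 hy
  refine ⟨y.hom, fun x => ?_⟩
  have := congrArg (fun t => t.hom x) this
  simpa using this

lemma EV.proj (hX : Module.Projective A X) (n : ℕ) : EV X Q (n + 1) := by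
  let _ : HasExt.{max u (v + 1)} (ModuleCat.{v} A) := HasExt.standard _
  intro x
  exact Ext.eq_zero_of_projective x

lemma desc {X Y : Type*} [AddCommGroup X] [AddCommGroup Y] [Module A X] [Module A Y]
    {Z : Type*} [AddCommGroup Z] [Module A Z]
    (g : X →ₗ[A] Y) (hg : Function.Surjective g) (h : X →ₗ[A] Z) (hh : ∀ x, g x = 0 → h x = 0) :
    ∃ k : Y →ₗ[A] Z, ∀ x, k (g x) = h x := by
  have key : ∀ x y, g x = g y → h x = h y := fun x y e =>
    sub_eq_zero.1 (by rw [← map_sub]; exact hh _ (by rw [map_sub, e, sub_self]))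
  refine ⟨{ toFun := fun y => h (Function.surjInv hg y), map_add' := ?_, map_smul' := ?_ }, ?_⟩
  · intro a b
    rw [← map_add]
    exact key _ _ (by simp [Function.surjInv_eq])
  · intro a b
    rw [RingHom.id_apply, ← map_smul]
    exact key _ _ (by simp [Function.surjInv_eq])
  · intro x
    exact key _ _ (by simp [Function.surjInv_eq])

lemma SES.of_surj {M N : ModuleCat.{v} A} (p : M →ₗ[A] N) (hp : Function.Surjective p) :
    SES (X := ModuleCat.of A (LinearMap.ker p)) (LinearMap.ker p).subtype p :=
  ⟨Subtype.val_injective, fun y => ⟨fun h => ⟨⟨y, h⟩, rfl⟩, fun ⟨x, hx⟩ => by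
    rw [← hx]; exact x.2⟩, hp⟩

lemma SES.of_inj {M N : ModuleCat.{v} A} (i : M →ₗ[A] N) (hi : Function.Injective i) :
    SES (Z := ModuleCat.of A (N ⧸ LinearMap.range i)) i (LinearMap.range i).mkQ :=
  ⟨hi, fun y => by simp, Submodule.mkQ_surjective _⟩

/-- X → Y → S and Y → P → V give X → P → C and S → C → V -/
lemma SES.comp {X Y S P V : ModuleCat.{v} A} {a : X →ₗ[A] Y} {b : Y →ₗ[A] S}
    {i : Y →ₗ[A] P} {q : P →ₗ[A] V} (h1 : SES a b) (h2 : SES i q) :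
    ∃ (C : ModuleCat.{v} A) (c : P →ₗ[A] C) (s : S →ₗ[A] C) (t : C →ₗ[A] V),
      SES (i ∘ₗ a) c ∧ SES s t := by
  obtain ⟨C, c, h3⟩ : ∃ (C : ModuleCat.{v} A) (c : P →ₗ[A] C), SES (i ∘ₗ a) c :=
    ⟨_, _, SES.of_inj (i ∘ₗ a) (h2.1.comp h1.1)⟩
  obtain ⟨s, hs⟩ := desc b h1.2.2 (c ∘ₗ i) (fun y hy => by
    obtain ⟨x, rfl⟩ := (h1.2.1 y).1 hy
    exact (h3.2.1 _).2 ⟨x, rfl⟩)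
  obtain ⟨t, ht⟩ := desc c h3.2.2 q (fun p hp => by
    obtain ⟨x, rfl⟩ := (h3.2.1 p).1 hp
    exact (h2.2.1 _).2 ⟨_, rfl⟩)
  refine ⟨_, c, s, t, h3, ?_, ?_, ?_⟩
  · rw [injective_iff_map_eq_zero]
    intro z hz
    obtain ⟨y, rfl⟩ := h1.2.2 z
    rw [hs] at hz
    obtain ⟨x, hx⟩ := (h3.2.1 _).1 hz
    exact (h1.2.1 _).2 ⟨x, h2.1 hx⟩
  · intro z
    obtain ⟨p, rfl⟩ := h3.2.2 z
    constructor
    · intro h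
      rw [ht] at h
      obtain ⟨y, rfl⟩ := (h2.2.1 p).1 h
      exact ⟨b y, hs y⟩
    · rintro ⟨w, hw⟩
      obtain ⟨y, rfl⟩ := h1.2.2 w
      rw [← hw, hs]
      exact (ht _).trans ((h2.2.1 _).2 ⟨y, rfl⟩)
  · intro z
    obtain ⟨p, rfl⟩ := h2.2.2 z
    exact ⟨c p, ht p⟩

/-- K → G → X, K → P → C with Ext¹(X,P) = 0 give G → P × X → C. -/
lemma SES.embed {K G X P C : ModuleCat.{v} A} {i : K →ₗ[A] G} {p : G →ₗ[A] X}
    {j : K →ₗ[A] P} {c : P →ₗ[A] C} (h1 : SES i p) (h2 : SES j c) (he : EV X P 1) :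
    ∃ (a : G →ₗ[A] ModuleCat.of A (P × X)) (b : ModuleCat.of A (P × X) →ₗ[A] C), SES a b := by
  obtain ⟨t, ht⟩ := he.extend h1 j
  obtain ⟨k, hk⟩ := desc p h1.2.2 (c ∘ₗ t) (fun y hy => by
    obtain ⟨x, rfl⟩ := (h1.2.1 y).1 hy
    exact (h2.2.1 _).2 ⟨x, (ht x).symm⟩)
  refine ⟨LinearMap.prod t p, LinearMap.coprod c (-k), ?_, ?_, ?_⟩
  · refine (injective_iff_map_eq_zero (LinearMap.prod t p)).2 ?_
    intro y hy
    have e1 : t y = 0 := congrArg Prod.fst hy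
    have e2 : p y = 0 := congrArg Prod.snd hy
    obtain ⟨x, rfl⟩ := (h1.2.1 y).1 e2
    rw [ht] at e1
    rw [(injective_iff_map_eq_zero j).1 h2.1 x e1, map_zero]
  · rintro ⟨y, x⟩
    obtain ⟨z, rfl⟩ := h1.2.2 x
    constructor
    · intro h
      have h' : c y + -(k (p z)) = 0 := h
      rw [hk] at h'
      have h'' : c (y - t z) = 0 := by rw [map_sub, sub_eq_add_neg]; exact h'
      obtain ⟨w, hw⟩ := (h2.2.1 _).1 h''
      refine ⟨z + i w, ?_⟩
      have e : p (i w) = 0 := (h1.2.1 _).2 ⟨w, rfl⟩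
      refine Prod.ext ?_ ?_
      · change t (z + i w) = y
        rw [map_add, ht, hw]; abel
      · change p (z + i w) = p z
        rw [map_add, e, add_zero]
    · rintro ⟨w, hw⟩
      have e1 : t w = y := congrArg Prod.fst hw
      have e2 : p w = p z := congrArg Prod.snd hw
      change c y + -(k (p z)) = 0
      rw [← e2, hk, ← e1]
      exact add_neg_cancel _
  · intro z
    obtain ⟨y, rfl⟩ := h2.2.2 z
    refine ⟨(y, 0), ?_⟩
    change c y + -(k 0) = _
    simp

/-- pushouts -/
lemma SES.pushout {S X G H T : ModuleCat.{v} A} {i : S →ₗ[A] X} {p : X →ₗ[A] G}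
    {j : S →ₗ[A] H} {q : H →ₗ[A] T} (h1 : SES i p) (h2 : SES j q) :
    ∃ (Y : ModuleCat.{v} A) (a : H →ₗ[A] Y) (b : Y →ₗ[A] G) (a' : X →ₗ[A] Y) (b' : Y →ₗ[A] T),
      SES a b ∧ SES a' b' := by
  let W := ModuleCat.of A (X × H)
  let m : S →ₗ[A] W := LinearMap.prod i (-j)
  have hm : Function.Injective m := fun x y h => h1.1 (congrArg Prod.fst h)
  obtain ⟨C, c, h3⟩ : ∃ (C : ModuleCat.{v} A) (c : W →ₗ[A] C), SES m c :=
    ⟨_, _, SES.of_inj m hm⟩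
  have hc : ∀ x y, c (x, y) = 0 ↔ ∃ s, i s = x ∧ - j s = y := fun x y =>
    (h3.2.1 (x, y)).trans ⟨fun ⟨s, hs⟩ => ⟨s, congrArg Prod.fst hs, congrArg Prod.snd hs⟩,
      fun ⟨s, hs, hs'⟩ => ⟨s, Prod.ext hs hs'⟩⟩
  obtain ⟨b, hb⟩ := desc c h3.2.2 (p ∘ₗ LinearMap.fst A X H) (by
    rintro ⟨x, y⟩ h
    obtain ⟨s, rfl, rfl⟩ := (hc _ _).1 h
    exact (h1.2.1 _).2 ⟨s, rfl⟩)
  obtain ⟨b', hb'⟩ := desc c h3.2.2 (q ∘ₗ LinearMap.snd A X H) (by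
    rintro ⟨x, y⟩ h
    obtain ⟨s, rfl, rfl⟩ := (hc _ _).1 h
    refine (h2.2.1 _).2 ⟨-s, map_neg _ _⟩)
  replace hb : ∀ x y, b (c (x, y)) = p x := fun x y => hb (x, y)
  replace hb' : ∀ x y, b' (c (x, y)) = q y := fun x y => hb' (x, y)
  have hadd : ∀ x y x' y', c (x, y) + c (x', y') = c (x + x', y + y') := fun x y x' y' =>
    (map_add c (x, y) (x', y')).symm
  have hsurj : ∀ z, ∃ x y, c (x, y) = z := fun z => by
    obtain ⟨⟨x, y⟩, rfl⟩ := h3.2.2 z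
    exact ⟨x, y, rfl⟩
  refine ⟨_, c ∘ₗ LinearMap.inr A X H, b, c ∘ₗ LinearMap.inl A X H, b', ⟨?_, ?_, ?_⟩, ?_, ?_, ?_⟩
  · refine (injective_iff_map_eq_zero (c ∘ₗ LinearMap.inr A X H)).2 fun y hy => ?_
    obtain ⟨s, hs, rfl⟩ := (hc _ _).1 hy
    rw [(injective_iff_map_eq_zero i).1 h1.1 s hs, map_zero, neg_zero]
  · intro z
    obtain ⟨x, y, rfl⟩ := hsurj z
    rw [hb]
    constructor
    · intro h
      obtain ⟨s, rfl⟩ := (h1.2.1 _).1 h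
      refine ⟨y + j s, ?_⟩
      change c (0, y + j s) = _
      rw [← sub_eq_zero, ← map_sub]
      exact (hc _ _).2 ⟨-s, by simp, by simp⟩
    · rintro ⟨w, hw⟩
      rw [← hb x y, ← hw]
      change b (c (0, w)) = 0
      rw [hb, map_zero]
  · intro z
    obtain ⟨x, rfl⟩ := h1.2.2 z
    exact ⟨c (x, 0), hb _ _⟩
  · refine (injective_iff_map_eq_zero (c ∘ₗ LinearMap.inl A X H)).2 fun y hy => ?_
    obtain ⟨s, rfl, hs⟩ := (hc _ _).1 hy
    rw [(injective_iff_map_eq_zero j).1 h2.1 s (neg_eq_zero.1 hs), map_zero]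
  · intro z
    obtain ⟨x, y, rfl⟩ := hsurj z
    rw [hb']
    constructor
    · intro h
      obtain ⟨s, rfl⟩ := (h2.2.1 _).1 h
      refine ⟨x + i s, ?_⟩
      change c (x + i s, 0) = _
      rw [← sub_eq_zero, ← map_sub]
      exact (hc _ _).2 ⟨s, by simp, by simp⟩
    · rintro ⟨w, hw⟩
      rw [← hb' x y, ← hw]
      change b' (c (w, 0)) = 0
      rw [hb', map_zero]
  · intro z
    obtain ⟨x, rfl⟩ := h2.2.2 z
    exact ⟨c (0, x), hb' _ _⟩

end Basics

section GP

variable {A : Type u} [Ring A]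

/-- `Ext^n(M, proj) = 0` for all `n > k` -/
def PerpK (k : ℕ) (M : ModuleCat.{v} A) : Prop :=
  ∀ Q : ModuleCat.{v} A, Module.Projective A Q → ∀ n, k < n → EV M Q n

/-- coinductive form of Gorenstein projectivity -/
def GPc (M : ModuleCat.{v} A) : Prop :=
  ∃ W : ModuleCat.{v} A → Prop, W M ∧ ∀ X, W X → PerpK 0 X ∧
    ∃ (P X' : ModuleCat.{v} A) (f : X →ₗ[A] P) (g : P →ₗ[A] X'),
      Module.Projective A P ∧ SES f g ∧ W X'

lemma GPc.perp {M : ModuleCat.{v} A} (h : GPc M) : PerpK 0 M := by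
  obtain ⟨W, hM, hW⟩ := h
  exact (hW M hM).1

lemma GPc.out {M : ModuleCat.{v} A} (h : GPc M) :
    ∃ (P X' : ModuleCat.{v} A) (f : M →ₗ[A] P) (g : P →ₗ[A] X'),
      Module.Projective A P ∧ SES f g ∧ GPc X' := by
  obtain ⟨W, hM, hW⟩ := h
  obtain ⟨-, P, X', f, g, hP, hs, h'⟩ := hW M hM
  exact ⟨P, X', f, g, hP, hs, W, h', hW⟩

lemma GPc.mk {M P X : ModuleCat.{v} A} {f : M →ₗ[A] P} {g : P →ₗ[A] X}
    (hM : PerpK 0 M) (hP : Module.Projective A P) (hs : SES f g) (hX : GPc X) : GPc M := by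
  refine ⟨fun Y => Y = M ∨ GPc Y, Or.inl rfl, ?_⟩
  rintro Y (rfl | h)
  · exact ⟨hM, P, X, f, g, hP, hs, Or.inr hX⟩
  · obtain ⟨P, X', f, g, hP, hs, h'⟩ := h.out
    exact ⟨h.perp, P, X', f, g, hP, hs, Or.inr h'⟩

lemma PerpK.mono {k l : ℕ} (hkl : k ≤ l) {M : ModuleCat.{v} A} (h : PerpK k M) : PerpK l M :=
  fun Q hQ n hn => h Q hQ n (by omega)

lemma PerpK.proj {P : ModuleCat.{v} A} (hP : Module.Projective A P) : PerpK 0 P := by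
  intro Q hQ n hn
  obtain ⟨m, rfl⟩ : ∃ m, n = m + 1 := ⟨n - 1, by omega⟩
  exact EV.proj hP m

section
variable {X Y Z : ModuleCat.{v} A} {f : X →ₗ[A] Y} {g : Y →ₗ[A] Z}

lemma PerpK.mid (h : SES f g) {k : ℕ} (h1 : PerpK k X) (h3 : PerpK k Z) : PerpK k Y :=
  fun Q hQ n hn => EV.mid h (h1 Q hQ n hn) (h3 Q hQ n hn)

lemma PerpK.left (h : SES f g) {k : ℕ} (h2 : PerpK k Y) (h3 : PerpK (k + 1) Z) : PerpK k X :=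
  fun Q hQ n hn => EV.left h (h2 Q hQ n hn) (h3 Q hQ (n + 1) (by omega))

lemma PerpK.right (h : SES f g) {k : ℕ} (h1 : PerpK k X) (h2 : PerpK (k + 1) Y) :
    PerpK (k + 1) Z := by
  intro Q hQ n hn
  obtain ⟨m, rfl⟩ : ∃ m, n = m + 1 := ⟨n - 1, by omega⟩
  exact EV.right h (h1 Q hQ m (by omega)) (h2 Q hQ (m + 1) (by omega))

end

lemma GPc.proj {P : ModuleCat.{v} A} (hP : Module.Projective A P) : GPc P := by
  refine ⟨fun X => Module.Projective A X, hP, fun X hX => ⟨PerpK.proj hX, X,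
    ModuleCat.of A PUnit, LinearMap.id, 0, hX, ⟨fun _ _ h => h, fun y => ?_, ?_⟩, ?_⟩⟩
  · simp
  · intro x
    exact ⟨0, rfl⟩
  · change Module.Projective A PUnit.{v + 1}
    infer_instance

lemma SES.prod_left {X Y Z : ModuleCat.{v} A} {f : X →ₗ[A] Y} {g : Y →ₗ[A] Z} (h : SES f g)
    (P : ModuleCat.{v} A) :
    ∃ (f' : ModuleCat.of A (P × X) →ₗ[A] ModuleCat.of A (P × Y))
      (g' : ModuleCat.of A (P × Y) →ₗ[A] Z), SES f' g' := by
  refine ⟨LinearMap.prodMap LinearMap.id f, g ∘ₗ LinearMap.snd A P Y, ?_, ?_, ?_⟩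
  · rintro ⟨a, b⟩ ⟨c, d⟩ e
    have e' : (a, f b) = (c, f d) := e
    rw [Prod.mk.injEq] at e'
    exact Prod.ext e'.1 (h.1 e'.2)
  · rintro ⟨a, b⟩
    constructor
    · intro e
      obtain ⟨x, rfl⟩ := (h.2.1 b).1 e
      exact ⟨(a, x), rfl⟩
    · rintro ⟨⟨c, d⟩, e⟩
      exact (h.2.1 b).2 ⟨d, congrArg Prod.snd e⟩
  · intro z
    obtain ⟨y, rfl⟩ := h.2.2 z
    exact ⟨(0, y), rfl⟩

/-- extension closure -/
lemma GPc.ext {X Y Z : ModuleCat.{v} A} {f : X →ₗ[A] Y} {g : Y →ₗ[A] Z} (h : SES f g)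
    (hX : GPc X) (hZ : GPc Z) : GPc Y := by
  refine ⟨fun Y => ∃ (X Z : ModuleCat.{v} A) (f : X →ₗ[A] Y) (g : Y →ₗ[A] Z), SES f g ∧
    GPc X ∧ GPc Z, ⟨X, Z, f, g, h, hX, hZ⟩, ?_⟩
  rintro E ⟨G, H, i, p, hs, hG, hH⟩
  refine ⟨PerpK.mid hs hG.perp hH.perp, ?_⟩
  obtain ⟨P1, G', i1, p1, hP1, hs1, hG'⟩ := hG.out
  obtain ⟨P2, H', i2, p2, hP2, hs2, hH'⟩ := hH.out
  obtain ⟨a, b, hab⟩ := SES.embed hs hs1 (hH.perp P1 hP1 1 one_pos)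
  obtain ⟨a', b', hab'⟩ := hs2.prod_left P1
  obtain ⟨C, c, s, t, h1, h2⟩ := hab.comp hab'
  refine ⟨_, C, _, c, ?_, h1, G', H', s, t, h2, hG', hH'⟩
  change Module.Projective A (P1 × P2)
  infer_instance

/-- a class of perpendicular modules coresolved by Gorenstein projectives -/
lemma GPc.of_class (K : ModuleCat.{v} A → Prop) (hK : ∀ X, K X → PerpK 0 X ∧
    ∃ (G X' : ModuleCat.{v} A) (f : X →ₗ[A] G) (g : G →ₗ[A] X'), GPc G ∧ SES f g ∧ K X')
    (M : ModuleCat.{v} A) (hM : K M) : GPc M := by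
  refine ⟨fun X => PerpK 0 X ∧ ∃ (Y S : ModuleCat.{v} A) (f : X →ₗ[A] Y) (g : Y →ₗ[A] S),
    SES f g ∧ GPc Y ∧ K S, ?_, ?_⟩
  · obtain ⟨h, G, X', f, g, hG, hs, hX'⟩ := hK M hM
    exact ⟨h, G, X', f, g, hs, hG, hX'⟩
  · rintro X ⟨hX, Y, S, f, g, hs, hY, hS⟩
    refine ⟨hX, ?_⟩
    obtain ⟨P, V, i, p, hP, hs', hV⟩ := hY.out
    obtain ⟨C, c, s, t, h1, h2⟩ := hs.comp hs'
    obtain ⟨hS0, G, S', j, q, hG, hs3, hS'⟩ := hK S hS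
    obtain ⟨E, a, b, a', b', h3, h4⟩ := SES.pushout h2 hs3
    exact ⟨P, C, _, c, hP, h1, PerpK.mid h2 hS0 hV.perp, E, S', a', b', h4,
      GPc.ext h3 hG hV, hS'⟩

lemma iso_perp {X Y : ModuleCat.{v} A} (e : X ≃ₗ[A] Y) {k : ℕ} (h : PerpK k X) : PerpK k Y := by
  have hz : Module.Projective A (ModuleCat.of A PUnit.{v + 1}) :=
    (inferInstance : Module.Projective A PUnit.{v + 1})
  refine PerpK.mid (X := X) (Z := ModuleCat.of A PUnit) (f := e.toLinearMap) (g := 0)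
    ⟨e.injective, fun y => ?_, fun x => ⟨0, rfl⟩⟩ h
    ((PerpK.proj hz).mono (Nat.zero_le _))
  exact ⟨fun _ => e.surjective y, fun _ => rfl⟩

lemma GPc.iso {X Y : ModuleCat.{v} A} (e : X ≃ₗ[A] Y) (h : GPc X) : GPc Y := by
  have hz : Module.Projective A (ModuleCat.of A PUnit.{v + 1}) :=
    (inferInstance : Module.Projective A PUnit.{v + 1})
  refine GPc.ext (X := X) (Z := ModuleCat.of A PUnit) (f := e.toLinearMap) (g := 0)
    ⟨e.injective, fun y => ?_, fun x => ⟨0, rfl⟩⟩ h (GPc.proj hz)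
  exact ⟨fun _ => e.surjective y, fun _ => rfl⟩

/-- every module is a quotient of a projective one -/
def EnoughP (A : Type u) [Ring A] : Prop :=
  ∀ M : ModuleCat.{v} A, ∃ (P : ModuleCat.{v} A) (p : P →ₗ[A] M), Module.Projective A P ∧
    Function.Surjective p

lemma cx_ses {C : ProjCx.{u, v} A} (hC : IsTotallyAcyclic C) (i : ℤ) :
    ∃ g : C.X i →ₗ[A] ModuleCat.of A (LinearMap.ker (C.d (i + 1))),
      SES (X := ModuleCat.of A (LinearMap.ker (C.d i))) (LinearMap.ker (C.d i)).subtype g ∧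
      ∀ x, (g x).1 = C.d i x := by
  have hr := hC.2.1 i
  refine ⟨LinearMap.codRestrict _ (C.d i) (fun x => by rw [← hr]; exact ⟨x, rfl⟩),
    ⟨Subtype.val_injective, fun y => ?_, ?_⟩, fun x => rfl⟩
  · constructor
    · intro h
      exact ⟨⟨y, congrArg Subtype.val h⟩, rfl⟩
    · rintro ⟨x, rfl⟩
      exact Subtype.ext x.2
  · rintro ⟨y, hy⟩
    rw [← hr] at hy
    obtain ⟨x, rfl⟩ := hy
    exact ⟨x, rfl⟩

lemma cx_perp {C : ProjCx.{u, v} A} (hC : IsTotallyAcyclic C) (Q : ModuleCat.{v} A)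
    (hQ : Module.Projective A Q) (n : ℕ) :
    ∀ i : ℤ, EV (ModuleCat.of A (LinearMap.ker (C.d i))) Q (n + 1) := by
  induction n with
  | zero =>
    intro i
    obtain ⟨j, rfl⟩ : ∃ j : ℤ, i = j + 1 + 1 + 1 := ⟨i - 3, by ring⟩
    obtain ⟨g, hg, hgd⟩ := cx_ses hC (j + 1 + 1)
    obtain ⟨g', hg', hgd'⟩ := cx_ses hC (j + 1)
    refine EV.of_extend hg (EV.proj (hC.1 _) 0) fun φ => ?_
    obtain ⟨h, hh⟩ := hC.2.2 Q hQ j (φ ∘ₗ g') (by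
      ext x
      change φ (g' (C.d j x)) = 0
      have : g' (C.d j x) = 0 := by
        apply Subtype.ext
        rw [hgd']
        have : C.d j x ∈ LinearMap.ker (C.d (j + 1)) := by
          rw [← hC.2.1]; exact ⟨x, rfl⟩
        exact this
      rw [this, map_zero])
    refine ⟨h, fun x => ?_⟩
    obtain ⟨y, rfl⟩ := hg'.2.2 x
    have := LinearMap.congr_fun hh y
    refine Eq.trans ?_ this
    change h (g' y).1 = h (C.d (j + 1) y)
    rw [hgd']
  | succ n ih =>
    intro i
    obtain ⟨j, rfl⟩ : ∃ j : ℤ, i = j + 1 := ⟨i - 1, by ring⟩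
    obtain ⟨g, hg, hgd⟩ := cx_ses hC j
    exact EV.right hg (ih j) (EV.proj (hC.1 _) _)

lemma cx_GPc {C : ProjCx.{u, v} A} (hC : IsTotallyAcyclic C) (i : ℤ) :
    GPc (ModuleCat.of A (LinearMap.ker (C.d i))) := by
  refine ⟨fun X => ∃ i, X = ModuleCat.of A (LinearMap.ker (C.d i)), ⟨i, rfl⟩, ?_⟩
  rintro X ⟨i, rfl⟩
  refine ⟨?_, ?_⟩
  · intro Q hQ n hn
    obtain ⟨m, rfl⟩ : ∃ m, n = m + 1 := ⟨n - 1, by omega⟩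
    exact cx_perp hC Q hQ m i
  · obtain ⟨g, hg, hgd⟩ := cx_ses hC i
    exact ⟨_, _, _, g, hC.1 i, hg, i + 1, rfl⟩

lemma GPc.of_frozen {M : ModuleCat.{v} A} (h : IsGorensteinProjective A M) : GPc M := by
  obtain ⟨C, hC, ⟨e⟩⟩ := h
  exact GPc.iso (X := ModuleCat.of A (LinearMap.ker (C.d 0))) e.symm (cx_GPc hC 0)

lemma frozen_quot {M : ModuleCat.{v} A} (h : IsGorensteinProjective A M) :
    ∃ (P : ModuleCat.{v} A) (p : P →ₗ[A] M), Module.Projective A P ∧ Function.Surjective p := by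
  obtain ⟨C, hC, ⟨e⟩⟩ := h
  have key : ∀ i : ℤ, ∃ (P : ModuleCat.{v} A) (p : P →ₗ[A] LinearMap.ker (C.d i)),
      Module.Projective A P ∧ Function.Surjective p := by
    intro i
    obtain ⟨j, rfl⟩ : ∃ j : ℤ, i = j + 1 := ⟨i - 1, by ring⟩
    obtain ⟨g, hg, hgd⟩ := cx_ses hC j
    exact ⟨_, g, hC.1 j, hg.2.2⟩
  obtain ⟨P, p, hP, hp⟩ := key 0
  exact ⟨P, e.symm.toLinearMap ∘ₗ p, hP, e.symm.surjective.comp hp⟩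

lemma int_chain {T : Type*} (R : T → T → Prop) (h1 : ∀ x, ∃ y, R x y) (h2 : ∀ x, ∃ y, R y x)
    (x : T) : ∃ W : ℤ → T, W 0 = x ∧ ∀ i, R (W i) (W (i + 1)) := by
  choose s hs using h1
  choose t ht using h2
  refine ⟨fun i => match i with
    | Int.ofNat n => s^[n] x
    | Int.negSucc n => t^[n + 1] x, rfl, ?_⟩
  rintro (n | n)
  · change R (s^[n] x) (s^[n + 1] x)
    rw [Function.iterate_succ_apply']
    exact hs _
  · cases n with
    | zero => exact ht x
    | succ n =>
      change R (t^[n + 1 + 1] x) (t^[n + 1] x)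
      rw [Function.iterate_succ_apply' t (n + 1)]
      exact ht _

lemma GPc.frozen (hE : EnoughP.{u, v} A) {M : ModuleCat.{v} A} (h : GPc M) :
    IsGorensteinProjective A M := by
  obtain ⟨W, hW0, hW⟩ := int_chain (T := {X : ModuleCat.{v} A // GPc X})
    (fun X Y => ∃ (P : ModuleCat.{v} A) (f : X.1 →ₗ[A] P) (g : P →ₗ[A] Y.1),
      Module.Projective A P ∧ SES f g)
    (fun X => by
      obtain ⟨P, X', f, g, hP, hs, h'⟩ := X.2.out
      exact ⟨⟨X', h'⟩, P, f, g, hP, hs⟩)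
    (fun X => by
      obtain ⟨P, p, hP, hp⟩ := hE X.1
      have hs := SES.of_surj p hp
      exact ⟨⟨_, GPc.mk (PerpK.left hs (PerpK.proj hP) (X.2.perp.mono (Nat.zero_le _))) hP hs X.2⟩,
        P, _, p, hP, hs⟩)
    ⟨M, h⟩
  choose P f g hP hs using hW
  have hk : ∀ i x, f (i + 1) (g i x) = 0 ↔ ∃ w, f i w = x := fun i x => by
    rw [← (hs i).2.1]
    exact map_eq_zero_iff _ (hs (i + 1)).1
  refine ⟨⟨P, fun i => f (i + 1) ∘ₗ g i⟩, ⟨hP, ?_, ?_⟩, ?_⟩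
  · intro i
    ext x
    constructor
    · rintro ⟨y, rfl⟩
      exact (hk _ _).2 ⟨_, rfl⟩
    · intro hx
      obtain ⟨w, rfl⟩ := (hk _ _).1 hx
      obtain ⟨y, rfl⟩ := (hs i).2.2 w
      exact ⟨y, rfl⟩
  · intro Q _ _ hQ i φ hφ
    change P (i + 1) →ₗ[A] Q at φ
    obtain ⟨k, hk'⟩ := desc (g (i + 1)) (hs (i + 1)).2.2 φ (fun x hx => by
      obtain ⟨w, rfl⟩ := ((hs (i + 1)).2.1 x).1 hx
      obtain ⟨y, rfl⟩ := (hs i).2.2 w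
      exact LinearMap.congr_fun hφ y)
    obtain ⟨ψ, hψ⟩ := EV.extend (Q := ModuleCat.of A Q) (hs (i + 1 + 1))
      ((W (i + 1 + 1 + 1)).2.perp (ModuleCat.of A Q) hQ 1 one_pos) k
    refine ⟨ψ, ?_⟩
    ext x
    exact (hψ _).trans (hk' x)
  · have e0 : (W 0).1 = M := by rw [hW0]
    subst e0
    refine ⟨LinearEquiv.ofBijective (LinearMap.codRestrict _ (f 0) (fun w => ?_)) ⟨?_, ?_⟩⟩
    · exact (hk 0 _).2 ⟨w, rfl⟩
    · intro a b hab
      exact (hs 0).1 (congrArg Subtype.val hab)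
    · rintro ⟨y, hy⟩
      obtain ⟨w, rfl⟩ := (hk 0 y).1 hy
      exact ⟨w, rfl⟩

lemma GpdLE.perp : ∀ (n : ℕ) (M : ModuleCat.{v} A), GpdLE A n M → PerpK n M
  | 0, _, h => (GPc.of_frozen h).perp
  | n + 1, _, ⟨_, f, hG, hf, hK⟩ =>
    PerpK.right (SES.of_surj f hf) (GpdLE.perp n _ hK)
      ((GPc.of_frozen hG).perp.mono (Nat.zero_le _))

lemma GPc.of_gpd : ∀ (n : ℕ) (M : ModuleCat.{v} A), GpdLE A n M → PerpK 0 M → GPc M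
  | 0, _, h, _ => GPc.of_frozen h
  | n + 1, M, ⟨G, f, hG, hf, hK⟩, hM => by
    replace hG := GPc.of_frozen hG
    have hs := SES.of_surj f hf
    have hK' := GPc.of_gpd n _ hK (PerpK.left hs hG.perp (hM.mono (Nat.zero_le _)))
    obtain ⟨P, C, i, c, hP, hs', hC⟩ := hK'.out
    obtain ⟨a, b, hab⟩ := SES.embed hs hs' (hM P hP 1 one_pos)
    have hPX := GPc.ext hab hG hC
    obtain ⟨P', V, i', c', hP', hs2, hV⟩ := hPX.out
    have hs3 : SES (Y := ModuleCat.of A (P × M)) (LinearMap.inr A P M) (LinearMap.fst A P M) := by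
      refine ⟨fun a b h => congrArg Prod.snd h, ?_, fun p => ⟨(p, 0), rfl⟩⟩
      rintro ⟨p, m⟩
      constructor
      · intro h
        exact ⟨m, Prod.ext (Eq.symm h) rfl⟩
      · rintro ⟨x, hx⟩
        exact (congrArg Prod.fst hx).symm
    obtain ⟨D, d, s, t, h1, h2⟩ := hs3.comp hs2
    exact GPc.mk hM hP' h1 (GPc.ext h2 (GPc.proj hP) hV)

lemma enough_of_gpd (n : ℕ) (h : ∀ M : ModuleCat.{v} A, GpdLE A n M) : EnoughP.{u, v} A := by
  intro M
  cases n with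
  | zero => exact frozen_quot (h M)
  | succ n =>
    obtain ⟨G, f, hG, hf, -⟩ := h M
    obtain ⟨P, p, hP, hp⟩ := frozen_quot hG
    exact ⟨P, f ∘ₗ p, hP, hf.comp hp⟩

end GP

section Change

variable {A : Type u} [Ring A] {B : Type u} [Ring B]

/-- the standing assumptions -/
structure Setup (ω : A) (σ : A ≃+* A) (π : A →+* B) : Prop where
  hσ : ∀ a : A, ω * a = σ a * ω
  hreg : ∀ a : A, a * ω = 0 → a = 0
  hreg' : ∀ a : A, ω * a = 0 → a = 0
  hπ : Function.Surjective π
  hker : ∀ x : A, π x = 0 ↔ ∃ a : A, x = a * ω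

variable {ω : A} {σ : A ≃+* A} {π : A →+* B}

lemma Setup.piω (S : Setup ω σ π) : π ω = 0 := (S.hker ω).2 ⟨1, (one_mul ω).symm⟩

lemma Setup.sω (S : Setup ω σ π) : σ ω = ω := by
  have h := S.hσ ω
  refine (sub_eq_zero.1 (S.hreg _ ?_)).symm
  rw [sub_mul, h, sub_self]

lemma Setup.ker' (S : Setup ω σ π) {x : A} (h : π x = 0) : ∃ a, x = ω * a := by
  obtain ⟨a, rfl⟩ := (S.hker x).1 h
  exact ⟨σ.symm a, by rw [S.hσ, σ.apply_symm_apply]⟩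

/-- `p : M → N` exhibits the `B`-module `N` as `M / ω M`. -/
def IsBar (ω : A) {M : ModuleCat.{v} A} {N : ModuleCat.{v} B} (p : M →ₛₗ[π] N) : Prop :=
  Function.Surjective p ∧ ∀ m, p m = 0 ↔ ∃ m', m = ω • m'

lemma descB (hπ : Function.Surjective π) {M : Type*} [AddCommGroup M] [Module A M]
    {N : Type*} [AddCommGroup N] [Module B N] {X : Type*} [AddCommGroup X] [Module B X]
    (p : M →ₛₗ[π] N) (hp : Function.Surjective p) (h : M →ₛₗ[π] X)
    (hh : ∀ m, p m = 0 → h m = 0) : ∃ k : N →ₗ[B] X, ∀ m, k (p m) = h m := by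
  have key : ∀ x y, p x = p y → h x = h y := fun x y e =>
    sub_eq_zero.1 (by rw [← map_sub]; exact hh _ (by rw [map_sub, e, sub_self]))
  refine ⟨{ toFun := fun y => h (Function.surjInv hp y), map_add' := ?_, map_smul' := ?_ }, ?_⟩
  · intro a b
    rw [← map_add]
    exact key _ _ (by simp [Function.surjInv_eq])
  · intro b y
    obtain ⟨a, rfl⟩ := hπ b
    rw [RingHom.id_apply, ← LinearMap.map_smulₛₗ]
    exact key _ _ (by simp [Function.surjInv_eq])
  · intro x
    exact key _ _ (by simp [Function.surjInv_eq])

lemma Setup.exists_bar (S : Setup ω σ π) (M : ModuleCat.{v} A) :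
    ∃ (N : ModuleCat.{v} B) (p : M →ₛₗ[π] N), IsBar ω p := by
  let U : Submodule A M :=
    { carrier := {m | ∃ m', m = ω • m'}
      add_mem' := by
        rintro _ _ ⟨a, rfl⟩ ⟨b, rfl⟩
        exact ⟨a + b, (smul_add _ _ _).symm⟩
      zero_mem' := ⟨0, (smul_zero _).symm⟩
      smul_mem' := by
        rintro c _ ⟨a, rfl⟩
        refine ⟨σ.symm c • a, ?_⟩
        rw [smul_smul, smul_smul, S.hσ, σ.apply_symm_apply] }
  let T := M ⧸ U
  let sm : SMul B T := ⟨fun b t => Function.surjInv S.hπ b • t⟩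
  have hsm : ∀ (c : A) (x : T), π c • x = c • x := by
    intro c x
    change Function.surjInv S.hπ (π c) • x = c • x
    rw [← sub_eq_zero, ← sub_smul]
    obtain ⟨a, ha⟩ := S.ker' (x := Function.surjInv S.hπ (π c) - c)
      (by rw [map_sub, Function.surjInv_eq S.hπ, sub_self])
    rw [ha]
    obtain ⟨m, rfl⟩ := Submodule.mkQ_surjective U x
    rw [← map_smul, mul_smul]
    exact (Submodule.Quotient.mk_eq_zero U).2 ⟨_, rfl⟩
  let md : Module B T := Function.Surjective.moduleLeft π S.hπ hsm
  refine ⟨ModuleCat.of B T, { toFun := U.mkQ, map_add' := map_add _, map_smul' := ?_ }, ?_, ?_⟩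
  · intro a m
    rw [map_smul]
    exact (hsm a _).symm
  · exact Submodule.mkQ_surjective U
  · intro m
    exact (Submodule.Quotient.mk_eq_zero U)

/-- restriction of scalars -/
noncomputable def Res {R S : Type*} [Ring R] [Ring S] (π : R →+* S) (N : ModuleCat.{v} S) : ModuleCat.{v} R :=
  (ModuleCat.restrictScalars π).obj N

/-- the identity as a semilinear map -/
noncomputable def resE {R S : Type*} [Ring R] [Ring S] (π : R →+* S) (N : ModuleCat.{v} S) : Res π N →ₛₗ[π] N where
  toFun x := x
  map_add' _ _ := rfl
  map_smul' _ _ := rfl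

lemma resE_bij {R S : Type*} [Ring R] [Ring S] (π : R →+* S) (N : ModuleCat.{v} S) :
    Function.Bijective (resE π N) := Function.bijective_id

/-- semilinear maps as linear maps into the restriction -/
noncomputable def toRes {R S : Type*} [Ring R] [Ring S] {π : R →+* S} {M : ModuleCat.{v} R} {N : ModuleCat.{v} S}
    (h : M →ₛₗ[π] N) : M →ₗ[R] Res π N where
  toFun x := h x
  map_add' := h.map_add
  map_smul' a x := h.map_smulₛₗ a x

lemma resE_toRes {R S : Type*} [Ring R] [Ring S] {π : R →+* S} {M : ModuleCat.{v} R}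
    {N : ModuleCat.{v} S} (h : M →ₛₗ[π] N) (x : M) : resE π N (toRes h x) = h x := rfl

lemma toRes_ses {R S : Type*} [Ring R] [Ring S] {π : R →+* S} {M : ModuleCat.{v} R}
    {N : ModuleCat.{v} S} (h : M →ₛₗ[π] N) (hh : Function.Surjective h) :
    SES (X := ModuleCat.of R (LinearMap.ker h)) (LinearMap.ker h).subtype (toRes h) :=
  ⟨Subtype.val_injective, fun y => ⟨fun h => ⟨⟨y, h⟩, rfl⟩, fun ⟨x, hx⟩ => by
    rw [← hx]; exact x.2⟩, hh⟩

/-- restriction of linear maps -/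
noncomputable def resMap {R S : Type*} [Ring R] [Ring S] (π : R →+* S) {M N : ModuleCat.{v} S} (f : M →ₗ[S] N) :
    Res π M →ₗ[R] Res π N where
  toFun x := f x
  map_add' := f.map_add
  map_smul' a x := f.map_smul (π a) x

lemma SES.res {R S : Type*} [Ring R] [Ring S] (π : R →+* S) {X Y Z : ModuleCat.{v} S}
    {f : X →ₗ[S] Y} {g : Y →ₗ[S] Z} (h : SES f g) : SES (resMap π f) (resMap π g) := h

lemma Setup.reg_proj (S : Setup ω σ π) {P : ModuleCat.{v} A} (hP : Module.Projective A P) (x : P)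
    (hx : ω • x = 0) : x = 0 := by
  obtain ⟨s, hs⟩ := hP.out
  have h0 : s x = 0 := by
    ext i
    have : (s (ω • x)) i = 0 := by rw [hx, map_zero]; rfl
    rw [map_smul] at this
    exact S.hreg' _ this
  rw [← hs x, h0, map_zero]

lemma Setup.reg_GP (S : Setup ω σ π) {G : ModuleCat.{v} A} (hG : GPc G) (x : G)
    (hx : ω • x = 0) : x = 0 := by
  obtain ⟨P, X, f, g, hP, hs, -⟩ := hG.out
  refine (injective_iff_map_eq_zero f).1 hs.1 x (S.reg_proj hP _ ?_)
  rw [← map_smul, hx, map_zero]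

lemma proj_twist (τ : A ≃+* A) {P P' : Type v} [AddCommGroup P] [AddCommGroup P'] [Module A P]
    [Module A P'] (hP : Module.Projective A P) (e : P →+ P') (he : Function.Bijective e)
    (hs : ∀ a x, e (a • x) = τ a • e x) : Module.Projective A P' := by
  letI : RingHomInvPair (τ : A →+* A) (τ.symm : A →+* A) := RingHomInvPair.of_ringEquiv τ
  letI : RingHomInvPair (τ.symm : A →+* A) (τ : A →+* A) := RingHomInvPair.of_ringEquiv τ.symm
  let e' : P →ₛₗ[(τ : A →+* A)] P' := { e with map_smul' := hs }
  let e'' : P ≃ₛₗ[(τ : A →+* A)] P' := LinearEquiv.ofBijective e' he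
  exact Module.Projective.of_equiv e''

lemma Setup.ker_proj (S : Setup ω σ π) {P : ModuleCat.{v} A} {F : ModuleCat.{v} B}
    {p : P →ₛₗ[π] F} (hp : IsBar ω p) (hP : Module.Projective A P) :
    Module.Projective A (LinearMap.ker p) := by
  have hm : ∀ x : P, ω • x ∈ LinearMap.ker p := fun x => (hp.2 _).2 ⟨x, rfl⟩
  refine proj_twist σ hP
    { toFun := fun x => ⟨ω • x, hm x⟩, map_zero' := ?_, map_add' := ?_ } ⟨?_, ?_⟩ ?_
  · exact Subtype.ext (smul_zero _)
  · intro x y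
    exact Subtype.ext (smul_add _ _ _)
  · intro x y h
    have h' : ω • x = ω • y := congrArg Subtype.val h
    exact sub_eq_zero.1 (S.reg_proj hP _ (by rw [smul_sub, h', sub_self]))
  · rintro ⟨y, hy⟩
    obtain ⟨x, rfl⟩ := (hp.2 _).1 hy
    exact ⟨x, rfl⟩
  · intro a x
    apply Subtype.ext
    change ω • a • x = σ a • ω • x
    rw [smul_smul, smul_smul, S.hσ]

lemma Setup.bar_proj (S : Setup ω σ π) {P : ModuleCat.{v} A} {F : ModuleCat.{v} B}
    {p : P →ₛₗ[π] F} (hp : IsBar ω p) (hP : Module.Projective A P) : Module.Projective B F := by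
  refine Module.Projective.of_lifting_property'' fun f hf => ?_
  letI : Module A (F →₀ B) := Module.compHom _ π
  letI : Module A F := Module.compHom _ π
  let f' : (F →₀ B) →ₗ[A] F := { toFun := f, map_add' := f.map_add, map_smul' := fun a x => f.map_smul (π a) x }
  let p' : P →ₗ[A] F := { toFun := p, map_add' := p.map_add, map_smul' := fun a x => p.map_smulₛₗ a x }
  obtain ⟨l, hl⟩ := Module.projective_lifting_property f' p' hf
  let l' : P →ₛₗ[π] (F →₀ B) := { toFun := l, map_add' := l.map_add, map_smul' := fun a x => l.map_smul a x }
  obtain ⟨k, hk⟩ := descB S.hπ p hp.1 l' (fun m hm => by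
    obtain ⟨x, rfl⟩ := (hp.2 m).1 hm
    rw [LinearMap.map_smulₛₗ, S.piω, zero_smul])
  refine ⟨k, ?_⟩
  ext y
  obtain ⟨x, rfl⟩ := hp.1 y
  change f (k (p x)) = p x
  rw [hk]
  exact LinearMap.congr_fun hl x

lemma Setup.perp_bar (S : Setup ω σ π) {P : ModuleCat.{v} A} {F : ModuleCat.{v} B}
    {p : P →ₛₗ[π] F} (hp : IsBar ω p) (hP : Module.Projective A P) : PerpK 1 (Res π F) :=
  PerpK.right (toRes_ses p hp.1) (PerpK.proj (S.ker_proj hp hP))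
    ((PerpK.proj hP).mono (Nat.zero_le _))

lemma Setup.enough_bar (S : Setup ω σ π) (hE : EnoughP.{u, v} A) (X : ModuleCat.{v} B) :
    ∃ (P : ModuleCat.{v} A) (f : P →ₛₗ[π] X) (F : ModuleCat.{v} B) (p : P →ₛₗ[π] F)
      (g : F →ₗ[B] X), Module.Projective A P ∧ Function.Surjective f ∧ IsBar ω p ∧
        (∀ x, g (p x) = f x) ∧ Function.Surjective g := by
  obtain ⟨P, f0, hP, hf0⟩ := hE (Res π X)
  let f : P →ₛₗ[π] X := (resE π X).comp f0
  have hf : Function.Surjective f := (resE_bij π X).2.comp hf0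
  obtain ⟨F, p, hp⟩ := S.exists_bar P
  obtain ⟨g, hg⟩ := descB S.hπ p hp.1 f (fun m hm => by
    obtain ⟨x, rfl⟩ := (hp.2 m).1 hm
    rw [LinearMap.map_smulₛₗ, S.piω, zero_smul])
  refine ⟨P, f, F, p, g, hP, hf, hp, hg, fun x => ?_⟩
  obtain ⟨y, rfl⟩ := hf x
  exact ⟨p y, hg y⟩

lemma Setup.enoughB (S : Setup ω σ π) (hE : EnoughP.{u, v} A) : EnoughP.{u, v} B := by
  intro X
  obtain ⟨P, f, F, p, g, hP, hf, hp, hg, hgs⟩ := S.enough_bar hE X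
  exact ⟨F, g, S.bar_proj hp hP, hgs⟩

/-- lifting along `Q → Q / ω Q` -/
lemma Setup.lift_bar (S : Setup ω σ π) {Q Z : ModuleCat.{v} A} {Qb : ModuleCat.{v} B}
    {q : Q →ₛₗ[π] Qb} (hq : IsBar ω q) (hQ : Module.Projective A Q)
    (hZ : ∀ Q' : ModuleCat.{v} A, Module.Projective A Q' → EV Z Q' 1) (φ : Z →ₛₗ[π] Qb) :
    ∃ h : Z →ₗ[A] Q, ∀ z, q (h z) = φ z :=
  EV.lift (toRes_ses q hq.1) (hZ (ModuleCat.of A (LinearMap.ker q)) (S.ker_proj hq hQ)) (toRes φ)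

/-- reduction of the target of extension problems to modules `Q / ω Q` -/
lemma Setup.extend_red (S : Setup ω σ π) (hE : EnoughP.{u, v} A) {X F : ModuleCat.{v} B}
    (i : X →ₗ[B] F)
    (h : ∀ (Q : ModuleCat.{v} A) (Qb : ModuleCat.{v} B) (q : Q →ₛₗ[π] Qb), Module.Projective A Q →
      IsBar ω q → ∀ φ : X →ₗ[B] Qb, ∃ ψ : F →ₗ[B] Qb, ∀ x, ψ (i x) = φ x)
    (Q : ModuleCat.{v} B) (hQ : Module.Projective B Q) (φ : X →ₗ[B] Q) :
    ∃ ψ : F →ₗ[B] Q, ∀ x, ψ (i x) = φ x := by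
  obtain ⟨P, f, Qb, q, g, hP, hf, hq, hg, hgs⟩ := S.enough_bar hE Q
  obtain ⟨s, hs⟩ := Module.projective_lifting_property g LinearMap.id hgs
  obtain ⟨ψ, hψ⟩ := h P Qb q hP hq (s ∘ₗ φ)
  refine ⟨g ∘ₗ ψ, fun x => ?_⟩
  change g (ψ (i x)) = φ x
  rw [hψ]
  exact LinearMap.congr_fun hs (φ x)

/-- change of rings for Ext -/
lemma Setup.change (S : Setup ω σ π) (hE : EnoughP.{u, v} A) (n : ℕ) : ∀ X : ModuleCat.{v} B,
    (∀ Q : ModuleCat.{v} A, Module.Projective A Q → EV (Res π X) Q (n + 2)) →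
    ∀ Q : ModuleCat.{v} B, Module.Projective B Q → EV X Q (n + 1) := by
  induction n with
  | zero =>
    intro X hX Q hQ
    obtain ⟨P, f, F, p, g, hP, hf, hp, hg, hgs⟩ := S.enough_bar hE X
    have hF := S.bar_proj hp hP
    have hs := SES.of_surj g hgs
    refine EV.of_extend hs (EV.proj hF 0) ?_
    refine S.extend_red hE _ ?_ Q hQ
    intro Q Qb q hQ hq φ
    have hs0 := toRes_ses f hf
    have hZ : ∀ Q' : ModuleCat.{v} A, Module.Projective A Q' →
        EV (ModuleCat.of A (LinearMap.ker f)) Q' 1 := fun Q' hQ' =>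
      EV.left hs0 (EV.proj hP 0) (hX Q' hQ')
    let r : LinearMap.ker f →ₛₗ[π] LinearMap.ker g :=
      { toFun := fun z => ⟨p z.1, by
          rw [LinearMap.mem_ker, hg]; exact z.2⟩
        map_add' := fun x y => Subtype.ext (map_add p _ _)
        map_smul' := fun a x => Subtype.ext (p.map_smulₛₗ a x.1) }
    obtain ⟨h, hh⟩ := S.lift_bar hq hQ hZ
      (LinearMap.comp (σ₁₂ := π) (σ₂₃ := RingHom.id B) (σ₁₃ := π) φ r)
    change LinearMap.ker f →ₗ[A] Q at h
    replace hh : ∀ z : LinearMap.ker f, q (h z) = φ (r z) := hh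
    have hm : ∀ x : P, ω • x ∈ LinearMap.ker f := fun x => by
      rw [LinearMap.mem_ker, LinearMap.map_smulₛₗ, S.piω, zero_smul]
    have hdiv : ∀ x : P, ∃ y : Q, h ⟨ω • x, hm x⟩ = ω • y := fun x => by
      refine (hq.2 _).1 ?_
      rw [hh]
      have : r ⟨ω • x, hm x⟩ = 0 := Subtype.ext ((hp.2 _).2 ⟨x, rfl⟩)
      rw [this, map_zero]
    choose k hk using hdiv
    have hinj : ∀ x y : Q, ω • x = ω • y → x = y := fun x y e =>
      sub_eq_zero.1 (S.reg_proj hQ _ (by rw [smul_sub, e, sub_self]))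
    let K : P →ₗ[A] Q :=
      { toFun := k
        map_add' := fun x y => hinj _ _ (by
          rw [smul_add, ← hk, ← hk, ← hk, ← map_add]
          exact congrArg h (Subtype.ext (smul_add _ _ _)))
        map_smul' := fun a x => hinj _ _ (by
          have e : ω • a • k x = σ a • ω • k x := by rw [smul_smul, smul_smul, S.hσ]
          rw [RingHom.id_apply, e, ← hk, ← hk, ← map_smul]
          refine congrArg h (Subtype.ext ?_)
          change ω • a • x = σ a • ω • x
          rw [smul_smul, smul_smul, S.hσ]) }
    have hKh : ∀ z : LinearMap.ker f, K z.1 = h z := fun z => hinj _ _ (by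
      change ω • k z.1 = _
      rw [← hk, ← map_smul]
      rfl)
    obtain ⟨ψ, hψ⟩ := descB S.hπ p hp.1
      (LinearMap.comp (σ₁₂ := RingHom.id A) (σ₂₃ := π) (σ₁₃ := π) q K) (fun m hm => by
        obtain ⟨x, rfl⟩ := (hp.2 m).1 hm
        rw [LinearMap.map_smulₛₗ, S.piω, zero_smul])
    refine ⟨ψ, ?_⟩
    rintro ⟨y, hy⟩
    obtain ⟨x, rfl⟩ := hp.1 y
    have hx : x ∈ LinearMap.ker f := by
      rw [LinearMap.mem_ker, ← hg]; exact hy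
    change ψ (p x) = _
    rw [hψ]
    change q (K x) = _
    rw [hKh ⟨x, hx⟩, hh]
    rfl
  | succ n ih =>
    intro X hX Q hQ
    obtain ⟨P, f, F, p, g, hP, hf, hp, hg, hgs⟩ := S.enough_bar hE X
    have hF := S.bar_proj hp hP
    have hs := SES.of_surj g hgs
    refine EV.right hs (ih _ (fun Q' hQ' => ?_) Q hQ) (EV.proj hF _)
    exact EV.left (hs.res π) (S.perp_bar hp hP Q' hQ' _ (by omega)) (hX Q' hQ')

lemma Setup.changeK (S : Setup ω σ π) (hE : EnoughP.{u, v} A) {X : ModuleCat.{v} B}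
    (h : PerpK 1 (Res π X)) : PerpK 0 X := by
  intro Q hQ n hn
  obtain ⟨m, rfl⟩ : ∃ m, n = m + 1 := ⟨n - 1, by omega⟩
  exact S.change hE m X (fun Q' hQ' => h Q' hQ' _ (by omega)) Q hQ

end Change

section Final

variable {A : Type u} [Ring A] {B : Type u} [Ring B]

lemma twist_EV (hE : EnoughP.{u, v} A) (τ : A ≃+* A) (n : ℕ) : ∀ (M M' : ModuleCat.{v} A)
    (e : M' →+ M), Function.Bijective e → (∀ a m, e (a • m) = τ a • e m) →
    (∀ Q : ModuleCat.{v} A, Module.Projective A Q → EV M Q (n + 1)) →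
    ∀ Q : ModuleCat.{v} A, Module.Projective A Q → EV M' Q (n + 1) := by
  induction n with
  | zero =>
    intro M M' e he hs hM Q hQ
    obtain ⟨P, f, hP, hf⟩ := hE M
    let E : M' ≃+ M := AddEquiv.ofBijective e he
    have hEs : ∀ a m, E.symm (τ a • m) = a • E.symm m := fun a m => by
      apply E.injective
      rw [E.apply_symm_apply]
      change _ = e (a • E.symm m)
      rw [hs]
      change _ = τ a • E (E.symm m)
      rw [E.apply_symm_apply]
    let P' := Res (τ : A →+* A) P
    have hP' : Module.Projective A P' :=
      proj_twist τ.symm hP (AddMonoidHom.id P) Function.bijective_id (fun a x => by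
        change a • x = τ (τ.symm a) • x
        rw [τ.apply_symm_apply])
    let f' : P' →ₗ[A] M' :=
      { toFun := fun x => E.symm (f x)
        map_add' := fun x y => by
          refine Eq.trans (congrArg E.symm (f.map_add x y)) (map_add E.symm _ _)
        map_smul' := fun a x => by
          refine Eq.trans (congrArg E.symm (f.map_smul (τ a) x)) (hEs a _) }
    have hf' : Function.Surjective f' := E.symm.surjective.comp hf
    have hker : ∀ x : P, f x = 0 → f' x = 0 := fun x hx => by
      change E.symm (f x) = 0
      rw [hx, map_zero]
    let Q1 := Res (τ.symm : A →+* A) Q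
    have hQ1 : Module.Projective A Q1 :=
      proj_twist τ hQ (AddMonoidHom.id Q) Function.bijective_id (fun a x => by
        change a • x = τ.symm (τ a) • x
        rw [τ.symm_apply_apply])
    refine EV.of_extend (SES.of_surj f' hf') (EV.proj hP' 0) fun φ => ?_
    change LinearMap.ker f' →ₗ[A] Q at φ
    let φ1 : LinearMap.ker f →ₗ[A] Q1 :=
      { toFun := fun z => φ ⟨z.1, hker z.1 z.2⟩
        map_add' := fun x y => φ.map_add ⟨x.1, hker x.1 x.2⟩ ⟨y.1, hker y.1 y.2⟩
        map_smul' := fun a x => by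
          refine Eq.trans (congrArg φ (Subtype.ext ?_))
            (φ.map_smul (τ.symm a) ⟨x.1, hker x.1 x.2⟩)
          change a • x.1 = τ (τ.symm a) • x.1
          rw [τ.apply_symm_apply] }
    obtain ⟨ψ, hψ⟩ := EV.extend (SES.of_surj f hf) (hM Q1 hQ1) φ1
    refine ⟨{ toFun := fun x => ψ x, map_add' := ψ.map_add, map_smul' := fun a x => ?_ }, ?_⟩
    · refine Eq.trans (ψ.map_smul (τ a) x) ?_
      change τ.symm (τ a) • (show Q from ψ x) = a • (show Q from ψ x)
      rw [τ.symm_apply_apply]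
    · intro z
      have hz : f z.1 = 0 := E.symm.injective (z.2.trans (map_zero E.symm).symm)
      exact hψ ⟨z.1, hz⟩
  | succ n ih =>
    intro M M' e he hs hM Q hQ
    obtain ⟨P, f, hP, hf⟩ := hE M
    let E : M' ≃+ M := AddEquiv.ofBijective e he
    have hEs : ∀ a m, E.symm (τ a • m) = a • E.symm m := fun a m => by
      apply E.injective
      rw [E.apply_symm_apply]
      change _ = e (a • E.symm m)
      rw [hs]
      change _ = τ a • E (E.symm m)
      rw [E.apply_symm_apply]
    let P' := Res (τ : A →+* A) P
    have hP' : Module.Projective A P' :=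
      proj_twist τ.symm hP (AddMonoidHom.id P) Function.bijective_id (fun a x => by
        change a • x = τ (τ.symm a) • x
        rw [τ.apply_symm_apply])
    let f' : P' →ₗ[A] M' :=
      { toFun := fun x => E.symm (f x)
        map_add' := fun x y => by
          refine Eq.trans (congrArg E.symm (f.map_add x y)) (map_add E.symm _ _)
        map_smul' := fun a x => by
          refine Eq.trans (congrArg E.symm (f.map_smul (τ a) x)) (hEs a _) }
    have hf' : Function.Surjective f' := E.symm.surjective.comp hf
    have hker : ∀ x : P, f x = 0 → f' x = 0 := fun x hx => by
      change E.symm (f x) = 0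
      rw [hx, map_zero]
    have hker' : ∀ x : P', f' x = 0 → f x = 0 := fun x hx =>
      E.symm.injective (hx.trans (map_zero E.symm).symm)
    refine EV.right (SES.of_surj f' hf') (ih (ModuleCat.of A (LinearMap.ker f))
      (ModuleCat.of A (LinearMap.ker f'))
      { toFun := fun z : LinearMap.ker f' => (⟨z.1, hker' z.1 z.2⟩ : LinearMap.ker f), map_zero' := rfl, map_add' := fun _ _ => rfl }
      ⟨?_, ?_⟩ ?_ ?_ Q hQ) (EV.proj hP' _)
    · intro x y h
      have h' : x.1 = y.1 := congrArg (fun w : LinearMap.ker f => w.1) h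
      exact Subtype.ext h'
    · intro z
      exact ⟨⟨z.1, hker z.1 z.2⟩, rfl⟩
    · intro a m
      rfl
    · intro Q hQ
      exact EV.left (SES.of_surj f hf) (EV.proj hP _) (hM Q hQ)

variable {ω : A} {σ : A ≃+* A} {π : A →+* B}

lemma Setup.bar_map (S : Setup ω σ π) {M N : ModuleCat.{v} A} {Mb Nb : ModuleCat.{v} B}
    {p : M →ₛₗ[π] Mb} {q : N →ₛₗ[π] Nb} (hp : IsBar ω p) (f : M →ₗ[A] N) :
    ∃ k : Mb →ₗ[B] Nb, ∀ m, k (p m) = q (f m) :=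
  descB S.hπ p hp.1 (LinearMap.comp (σ₁₂ := RingHom.id A) (σ₂₃ := π) (σ₁₃ := π) q f)
    (fun m hm => by
      obtain ⟨x, rfl⟩ := (hp.2 m).1 hm
      rw [LinearMap.map_smulₛₗ, S.piω, zero_smul])

lemma Setup.bar_ses (S : Setup ω σ π) {X Y Z : ModuleCat.{v} A} {Xb Yb Zb : ModuleCat.{v} B}
    {p : X →ₛₗ[π] Xb} {q : Y →ₛₗ[π] Yb} {r : Z →ₛₗ[π] Zb} (hp : IsBar ω p) (hq : IsBar ω q)
    (hr : IsBar ω r) {f : X →ₗ[A] Y} {g : Y →ₗ[A] Z} (hs : SES f g)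
    (hZ : ∀ z : Z, ω • z = 0 → z = 0) {fb : Xb →ₗ[B] Yb} {gb : Yb →ₗ[B] Zb}
    (hfb : ∀ m, fb (p m) = q (f m)) (hgb : ∀ m, gb (q m) = r (g m)) : SES fb gb := by
  refine ⟨?_, ?_, ?_⟩
  · refine (injective_iff_map_eq_zero fb).2 fun y hy => ?_
    obtain ⟨x, rfl⟩ := hp.1 y
    rw [hfb] at hy
    obtain ⟨y, hy⟩ := (hq.2 _).1 hy
    have h0 : g y = 0 := hZ _ (by
      rw [← map_smul, ← hy]; exact (hs.2.1 _).2 ⟨x, rfl⟩)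
    obtain ⟨x', rfl⟩ := (hs.2.1 _).1 h0
    refine (hp.2 _).2 ⟨x', hs.1 ?_⟩
    rw [hy, map_smul]
  · intro y
    constructor
    · intro hy
      obtain ⟨y, rfl⟩ := hq.1 y
      rw [hgb] at hy
      obtain ⟨z, hz⟩ := (hr.2 _).1 hy
      obtain ⟨y', rfl⟩ := hs.2.2 z
      have h0 : g (y - ω • y') = 0 := by rw [map_sub, map_smul, hz, sub_self]
      obtain ⟨x, hx⟩ := (hs.2.1 _).1 h0
      refine ⟨p x, ?_⟩
      rw [hfb, hx, map_sub, (hq.2 (ω • y')).2 ⟨_, rfl⟩, sub_zero]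
    · rintro ⟨x, rfl⟩
      obtain ⟨x, rfl⟩ := hp.1 x
      rw [hfb, hgb, (hs.2.1 _).2 ⟨x, rfl⟩, map_zero]
  · intro z
    obtain ⟨z, rfl⟩ := hr.1 z
    obtain ⟨y, rfl⟩ := hs.2.2 z
    exact ⟨q y, hgb y⟩

lemma Setup.bar_EV (S : Setup ω σ π) (hE : EnoughP.{u, v} A) (n : ℕ) :
    ∀ (G : ModuleCat.{v} A) (N : ModuleCat.{v} B) (p : G →ₛₗ[π] N), GPc G → IsBar ω p →
    ∀ Q : ModuleCat.{v} B, Module.Projective B Q → EV N Q (n + 1) := by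
  induction n with
  | zero =>
    intro G' N' r hG' hr
    obtain ⟨P, g, hP, hg⟩ := hE G'
    have hs := SES.of_surj g hg
    have hG : GPc (ModuleCat.of A (LinearMap.ker g)) :=
      GPc.mk (PerpK.left hs (PerpK.proj hP) (hG'.perp.mono (Nat.zero_le _))) hP hs hG'
    obtain ⟨N, p, hp⟩ := S.exists_bar (ModuleCat.of A (LinearMap.ker g))
    obtain ⟨F, q, hq⟩ := S.exists_bar P
    obtain ⟨fb, hfb⟩ := S.bar_map (q := q) hp (LinearMap.ker g).subtype
    obtain ⟨gb, hgb⟩ := S.bar_map (q := r) hq g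
    have hsb := S.bar_ses hp hq hr hs (fun z => S.reg_GP hG' z) hfb hgb
    intro Q hQ
    refine EV.of_extend hsb (EV.proj (S.bar_proj hq hP) 0) ?_
    refine S.extend_red hE _ ?_ Q hQ
    intro Q Qb t hQ ht φ
    obtain ⟨h, hh⟩ := S.lift_bar ht hQ (fun Q' hQ' => hG.perp Q' hQ' 1 Nat.one_pos)
      (LinearMap.comp (σ₁₂ := π) (σ₂₃ := RingHom.id B) (σ₁₃ := π) φ p)
    obtain ⟨k, hk⟩ := EV.extend hs (hG'.perp Q hQ 1 Nat.one_pos) h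
    obtain ⟨ψ, hψ⟩ := S.bar_map (q := t) hq k
    refine ⟨ψ, fun x => ?_⟩
    obtain ⟨x, rfl⟩ := hp.1 x
    rw [hfb, hψ, hk, hh]
    rfl
  | succ n ih =>
    intro G' N' r hG' hr
    obtain ⟨P, g, hP, hg⟩ := hE G'
    have hs := SES.of_surj g hg
    have hG : GPc (ModuleCat.of A (LinearMap.ker g)) :=
      GPc.mk (PerpK.left hs (PerpK.proj hP) (hG'.perp.mono (Nat.zero_le _))) hP hs hG'
    obtain ⟨N, p, hp⟩ := S.exists_bar (ModuleCat.of A (LinearMap.ker g))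
    obtain ⟨F, q, hq⟩ := S.exists_bar P
    obtain ⟨fb, hfb⟩ := S.bar_map (q := q) hp (LinearMap.ker g).subtype
    obtain ⟨gb, hgb⟩ := S.bar_map (q := r) hq g
    have hsb := S.bar_ses hp hq hr hs (fun z => S.reg_GP hG' z) hfb hgb
    intro Q hQ
    exact EV.right hsb (ih _ N p hG hp Q hQ) (EV.proj (S.bar_proj hq hP) _)

lemma Setup.bar_GPc (S : Setup ω σ π) (hE : EnoughP.{u, v} A)
    (G : ModuleCat.{v} A) (N : ModuleCat.{v} B) (p : G →ₛₗ[π] N) (hG : GPc G) (hp : IsBar ω p) :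
    GPc N := by
  refine ⟨fun N => ∃ (G : ModuleCat.{v} A) (p : G →ₛₗ[π] N), GPc G ∧ IsBar ω p,
    ⟨G, p, hG, hp⟩, ?_⟩
  rintro N ⟨G, p, hG, hp⟩
  refine ⟨?_, ?_⟩
  · intro Q hQ n hn
    obtain ⟨m, rfl⟩ : ∃ m, n = m + 1 := ⟨n - 1, by omega⟩
    exact S.bar_EV hE m G N p hG hp Q hQ
  · obtain ⟨P, G', f, g, hP, hs, hG'⟩ := hG.out
    obtain ⟨F, q, hq⟩ := S.exists_bar P
    obtain ⟨N', r, hr⟩ := S.exists_bar G'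
    obtain ⟨fb, hfb⟩ := S.bar_map (q := q) hp f
    obtain ⟨gb, hgb⟩ := S.bar_map (q := r) hq g
    exact ⟨F, N', fb, gb, S.bar_proj hq hP,
      S.bar_ses hp hq hr hs (fun z => S.reg_GP hG' z) hfb hgb, G', r, hG', hr⟩

lemma Setup.exists_sB (S : Setup ω σ π) :
    ∃ s : B →+* B, (∀ a, s (π a) = π (σ a)) ∧ Function.Surjective s := by
  have hk : ∀ a, π a = 0 → π (σ a) = 0 := fun a ha => by
    obtain ⟨b, rfl⟩ := (S.hker a).1 ha
    rw [map_mul, S.sω]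
    exact (S.hker _).2 ⟨_, rfl⟩
  have key : ∀ x y, π x = π y → π (σ x) = π (σ y) := fun x y e =>
    sub_eq_zero.1 (by rw [← map_sub, ← map_sub]; exact hk _ (by rw [map_sub, e, sub_self]))
  have hr := Function.surjInv_eq S.hπ
  refine ⟨
    { toFun := fun b => π (σ (Function.surjInv S.hπ b))
      map_one' := ?_
      map_mul' := ?_
      map_zero' := ?_
      map_add' := ?_ }, ?_, ?_⟩
  · rw [key _ 1 (by rw [hr, map_one]), map_one, map_one]
  · intro x y
    rw [← map_mul, ← map_mul]
    exact key _ _ (by rw [map_mul, hr, hr, hr])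
  · rw [key _ 0 (by rw [hr, map_zero]), map_zero, map_zero]
  · intro x y
    rw [← map_add, ← map_add]
    exact key _ _ (by rw [map_add, hr, hr, hr])
  · intro a
    exact key _ _ (hr _)
  · intro b
    obtain ⟨a, rfl⟩ := S.hπ b
    refine ⟨π (σ.symm a), ?_⟩
    refine (key _ _ (hr _)).trans ?_
    rw [σ.apply_symm_apply]

lemma Setup.twist (_S : Setup ω σ π) (hE : EnoughP.{u, v} A) {s : B →+* B}
    (hs : ∀ a, s (π a) = π (σ a)) {K : ModuleCat.{v} B} (h : PerpK 1 (Res π K)) :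
    PerpK 1 (Res π (Res s K)) := by
  intro Q hQ n hn
  obtain ⟨m, rfl⟩ : ∃ m, n = m + 1 := ⟨n - 1, by omega⟩
  refine twist_EV hE σ m (Res π K) (Res π (Res s K)) (AddMonoidHom.id K) Function.bijective_id
    (fun a x => ?_) (fun Q hQ => h Q hQ _ hn) Q hQ
  change s (π a) • (show K from x) = π (σ a) • (show K from x)
  rw [hs]

lemma Setup.class_step (S : Setup ω σ π) (hE : EnoughP.{u, v} A) {d : ℕ}
    (hA : ∀ L : ModuleCat.{v} A, GpdLE A d L) (K : ModuleCat.{v} B) (hK : PerpK 1 (Res π K)) :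
    ∃ (G X' : ModuleCat.{v} B) (f : K →ₗ[B] G) (g : G →ₗ[B] X'), GPc G ∧ SES f g ∧
      PerpK 1 (Res π X') := by
  obtain ⟨s, hs, -⟩ := S.exists_sB
  have hK1 := S.twist hE hs hK
  obtain ⟨P, f, F, p, g, hP, hf, hp, hg, hgs⟩ := S.enough_bar hE (Res s K)
  have hs0 := toRes_ses f hf
  have hZ : GPc (ModuleCat.of A (LinearMap.ker f)) :=
    GPc.of_gpd d _ (hA _) (PerpK.left hs0 (PerpK.proj hP) hK1)
  obtain ⟨N, r, hr⟩ := S.exists_bar (ModuleCat.of A (LinearMap.ker f))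
  change LinearMap.ker f →ₛₗ[π] N at r
  have hr1 : Function.Surjective r := hr.1
  have hr2 : ∀ m : LinearMap.ker f, r m = 0 ↔ ∃ m' : LinearMap.ker f, m = ω • m' := hr.2
  have hN := S.bar_GPc hE _ N r hZ hr
  have hm : ∀ x : P, ω • x ∈ LinearMap.ker f := fun x => by
    rw [LinearMap.mem_ker, LinearMap.map_smulₛₗ, S.piω, zero_smul]
  -- the connecting map
  have hw : ∀ x : P, f x = 0 ↔ r ⟨ω • x, hm x⟩ = 0 := fun x => by
    rw [hr2]
    constructor
    · intro h
      exact ⟨⟨x, h⟩, rfl⟩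
    · rintro ⟨z, hz⟩
      have e : ω • x = ω • z.1 := congrArg Subtype.val hz
      have : x = z.1 := sub_eq_zero.1 (S.reg_proj hP _ (by rw [smul_sub, e, sub_self]))
      rw [this]
      exact z.2
  let t : P → N := fun x => r ⟨ω • x, hm x⟩
  have ht_add : ∀ x y, t (x + y) = t x + t y := fun x y => by
    change r _ = r _ + r _
    rw [← map_add]
    exact congrArg r (Subtype.ext (smul_add _ _ _))
  have ht_smul : ∀ (a : A) (x : P), t (a • x) = π (σ a) • t x := fun a x => by
    change r _ = π (σ a) • r _
    rw [← LinearMap.map_smulₛₗ]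
    refine congrArg r (Subtype.ext ?_)
    change ω • a • x = σ a • ω • x
    rw [smul_smul, smul_smul, S.hσ]
  have ht0 : ∀ x, f x = 0 ↔ t x = 0 := hw
  have ht_key : ∀ x y, f x = f y → t x = t y := fun x y e => by
    have h1 : f (x - y) = 0 := by rw [map_sub, e, sub_self]
    have h2 := (ht0 _).1 h1
    have h3 := ht_add (x - y) y
    rw [sub_add_cancel, h2, zero_add] at h3
    exact h3
  let fK : P → K := fun x => f x
  have hfK_smul : ∀ (a : A) (x : P), fK (a • x) = π (σ a) • fK x := fun a x => by
    refine Eq.trans (f.map_smulₛₗ a x) ?_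
    change s (π a) • fK x = _
    rw [hs]
  have hfK : Function.Surjective fK := hf
  have hfK_add : ∀ x y, fK (x + y) = fK x + fK y := f.map_add
  have hfK_key : ∀ x y, fK x = fK y → t x = t y := ht_key
  have hinv := Function.surjInv_eq hfK
  let θ : K →ₗ[B] N :=
    { toFun := fun k => t (Function.surjInv hfK k)
      map_add' := fun x y => by
        rw [← ht_add]
        exact hfK_key _ _ (by rw [hfK_add, hinv, hinv, hinv])
      map_smul' := fun b x => by
        obtain ⟨a, rfl⟩ := S.hπ b
        obtain ⟨a, rfl⟩ := σ.surjective a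
        rw [RingHom.id_apply, ← ht_smul]
        exact hfK_key _ _ (by rw [hfK_smul, hinv, hinv]) }
  have hθ : ∀ x, θ (fK x) = t x := fun x => hfK_key _ _ (hinv _)
  have hL := SES.of_surj g hgs
  let c : LinearMap.ker f →ₛₗ[π] LinearMap.ker g :=
    { toFun := fun z => ⟨p z.1, by
        rw [LinearMap.mem_ker, hg]; exact z.2⟩
      map_add' := fun x y => Subtype.ext (map_add p _ _)
      map_smul' := fun a x => Subtype.ext (p.map_smulₛₗ a x.1) }
  obtain ⟨k, hk⟩ := descB S.hπ r hr1 c (fun m hm => by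
    obtain ⟨x, rfl⟩ := (hr2 m).1 hm
    rw [LinearMap.map_smulₛₗ, S.piω, zero_smul])
  refine ⟨N, ModuleCat.of B (LinearMap.ker g), θ, k, hN, ⟨?_, ?_, ?_⟩, ?_⟩
  · refine (injective_iff_map_eq_zero θ).2 fun y hy => ?_
    obtain ⟨x, rfl⟩ := hfK y
    rw [hθ] at hy
    exact (ht0 x).2 hy
  · intro y
    constructor
    · intro hy
      obtain ⟨z, rfl⟩ := hr1 y
      have hy' : c z = 0 := (hk z).symm.trans hy
      obtain ⟨x, hx⟩ := (hp.2 z.1).1 (congrArg Subtype.val hy')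
      refine ⟨fK x, (hθ x).trans (congrArg r (Subtype.ext hx.symm))⟩
    · rintro ⟨y, rfl⟩
      obtain ⟨x, rfl⟩ := hfK y
      rw [hθ]
      refine (hk _).trans (Subtype.ext ?_)
      exact (hp.2 _).2 ⟨x, rfl⟩
  · rintro ⟨y, hy⟩
    obtain ⟨x, rfl⟩ := hp.1 y
    have hx : f x = 0 := by rw [← hg]; exact hy
    exact ⟨r ⟨x, hx⟩, hk _⟩
  · exact PerpK.left (hL.res π) (S.perp_bar hp hP) (hK1.mono (by omega))

lemma Setup.final (S : Setup ω σ π) (hE : EnoughP.{u, v} A) {d : ℕ}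
    (hA : ∀ L : ModuleCat.{v} A, GpdLE A d L) (n : ℕ) : ∀ N : ModuleCat.{v} B,
    PerpK (n + 1) (Res π N) → GpdLE B n N := by
  induction n with
  | zero =>
    intro N hN
    exact GPc.frozen (S.enoughB hE) (GPc.of_class (fun K => PerpK 1 (Res π K))
      (fun K hK => ⟨S.changeK hE hK, S.class_step hE hA K hK⟩) N hN)
  | succ n ih =>
    intro N hN
    obtain ⟨P, f, F, p, g, hP, hf, hp, hg, hgs⟩ := S.enough_bar hE N
    refine ⟨F, g, GPc.frozen (S.enoughB hE) (GPc.proj (S.bar_proj hp hP)), hgs, ih _ ?_⟩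
    exact PerpK.left ((SES.of_surj g hgs).res π) ((S.perp_bar hp hP).mono (by omega)) hN

end Final

end GorQuot

theorem quotient_left_gorenstein
    {A : Type u} [Ring A] (ω : A) (σ : A ≃+* A)
    (hσ : ∀ a : A, ω * a = σ a * ω)
    (hreg : ∀ a : A, a * ω = 0 → a = 0) (hreg' : ∀ a : A, ω * a = 0 → a = 0)
    {B : Type u} [Ring B] (π : A →+* B) (hπ : Function.Surjective π)
    (hker : ∀ x : A, π x = 0 ↔ ∃ a : A, x = a * ω)
    (d : ℕ) (hd : 1 ≤ d)
    (hA : ∀ L : ModuleCat.{v} A, GpdLE A d L) :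
    ∀ N : ModuleCat.{v} B, GpdLE B (d - 1) N := by
  have S : GorQuot.Setup ω σ π := ⟨hσ, hreg, hreg', hπ, hker⟩
  obtain ⟨n, rfl⟩ : ∃ n, d = n + 1 := ⟨d - 1, by omega⟩
  intro N
  exact S.final (GorQuot.enough_of_gpd _ hA) hA n N (GorQuot.GpdLE.perp _ _ (hA _))
end

section
/- Let N be a nonzero Gorenstein projective Ā-module. If N has finite projective dimension as an A-module, then pd_A(N) = 1. -/
/-!
STATEMENT 7: Let `ω ∈ A` be regular and normal and `Ā = A/(ω)` (realized by a
surjective ring homomorphism `π : A → B` with kernel `Aω`).  If `N` is a nonzero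
Gorenstein projective `B`-module of finite projective dimension over `A`, then
`pd_A(N) = 1`.
-/

universe u v

/-- `PdLE A n L` : the projective dimension of `L` over `A` is at most `n`. -/
def PdLE (A : Type u) [Ring A] : ℕ → ModuleCat.{v} A → Prop
  | 0, L => Module.Projective A L
  | n + 1, L => ∃ (G : ModuleCat.{v} A) (f : G →ₗ[A] L),
      Module.Projective A G ∧ Function.Surjective f ∧
        PdLE A n (ModuleCat.of A (LinearMap.ker f))

section Helpers

/-! ### Twisting -/

/-- The twist of a module by a ring automorphism. -/
def Tw {A : Type u} [Ring A] (_σ : A ≃+* A) (M : Type v) : Type v := M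

instance Tw.addCommGroup {A : Type u} [Ring A] (σ : A ≃+* A) (M : Type v) [h : AddCommGroup M] :
    AddCommGroup (Tw σ M) := h

instance Tw.module {A : Type u} [Ring A] (σ : A ≃+* A) (M : Type v) [AddCommGroup M]
    [Module A M] : Module A (Tw σ M) := Module.compHom M (σ : A →+* A)

/-- The identity map to the twist. -/
def Tw.mk {A : Type u} [Ring A] (σ : A ≃+* A) (M : Type v) [AddCommGroup M] : M ≃+ Tw σ M :=
  AddEquiv.refl M

theorem Tw.smul_mk {A : Type u} [Ring A] (σ : A ≃+* A) {M : Type v} [AddCommGroup M]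
    [Module A M] (a : A) (m : M) : a • Tw.mk σ M m = Tw.mk σ M (σ a • m) := rfl

theorem Tw.symm_smul {A : Type u} [Ring A] (σ : A ≃+* A) {M : Type v} [AddCommGroup M]
    [Module A M] (a : A) (m : Tw σ M) :
    (Tw.mk σ M).symm (a • m) = σ a • (Tw.mk σ M).symm m := rfl

theorem Tw.projective {A : Type u} [Ring A] (σ : A ≃+* A) (M : Type v) [AddCommGroup M]
    [Module A M] (h : Module.Projective A M) : Module.Projective A (Tw σ M) := by
  apply Module.Projective.of_lifting_property''
  intro f hf
  -- `f : (Tw σ M →₀ A) → Tw σ M`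
  let f' : Tw σ.symm (Tw σ M →₀ A) →ₗ[A] M :=
    { toFun := fun x => (Tw.mk σ M).symm (f ((Tw.mk σ.symm _).symm x))
      map_add' := fun x y => by simp
      map_smul' := fun a x => by
        simp [Tw.symm_smul] }
  have hf' : Function.Surjective f' := fun m => by
    obtain ⟨x, hx⟩ := hf (Tw.mk σ M m)
    exact ⟨Tw.mk σ.symm _ x, by simp [f', hx]⟩
  obtain ⟨g, hg⟩ := Module.projective_lifting_property f' LinearMap.id hf'
  refine ⟨{ toFun := fun x => (Tw.mk σ.symm _).symm (g ((Tw.mk σ M).symm x))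
            map_add' := fun x y => by simp
            map_smul' := fun a x => by simp [Tw.symm_smul] }, ?_⟩
  ext x
  have := LinearMap.congr_fun hg ((Tw.mk σ M).symm x)
  exact this

/-! ### Generalities on projective modules -/

/-- A surjection onto a projective with an arbitrary kernel: Schanuel's lemma. -/
theorem schanuel {R : Type u} [Ring R] {M P₁ P₂ : Type v} [AddCommGroup M] [Module R M]
    [AddCommGroup P₁] [Module R P₁] [AddCommGroup P₂] [Module R P₂]
    (h₁ : Module.Projective R P₁) (h₂ : Module.Projective R P₂)
    (f₁ : P₁ →ₗ[R] M) (f₂ : P₂ →ₗ[R] M)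
    (hf₁ : Function.Surjective f₁) (hf₂ : Function.Surjective f₂) :
    Nonempty ((LinearMap.ker f₁ × P₂) ≃ₗ[R] (LinearMap.ker f₂ × P₁)) := by
  obtain ⟨a, ha⟩ := Module.projective_lifting_property f₂ f₁ hf₂
  obtain ⟨b, hb⟩ := Module.projective_lifting_property f₁ f₂ hf₁
  have ha' : ∀ x, f₂ (a x) = f₁ x := fun x => LinearMap.congr_fun ha x
  have hb' : ∀ x, f₁ (b x) = f₂ x := fun x => LinearMap.congr_fun hb x
  -- (k, y) ↦ x := k + b y, then (y - a x, x)
  let F : (LinearMap.ker f₁ × P₂) →ₗ[R] P₁ :=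
    (LinearMap.ker f₁).subtype ∘ₗ LinearMap.fst R _ _ + b ∘ₗ LinearMap.snd R _ _
  let F' : (LinearMap.ker f₂ × P₁) →ₗ[R] P₂ :=
    (LinearMap.ker f₂).subtype ∘ₗ LinearMap.fst R _ _ + a ∘ₗ LinearMap.snd R _ _
  have hF : ∀ z, f₁ (F z) = f₂ z.2 := fun z => by
    simp [F, hb']
  have hF' : ∀ z, f₂ (F' z) = f₁ z.2 := fun z => by
    simp [F', ha']
  let G : (LinearMap.ker f₁ × P₂) →ₗ[R] (LinearMap.ker f₂ × P₁) :=
    ((LinearMap.snd R _ _ - a ∘ₗ F).codRestrict (LinearMap.ker f₂)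
      (fun z => by simp [ha', hF])).prod F
  let G' : (LinearMap.ker f₂ × P₁) →ₗ[R] (LinearMap.ker f₁ × P₂) :=
    ((LinearMap.snd R _ _ - b ∘ₗ F').codRestrict (LinearMap.ker f₁)
      (fun z => by simp [hb', hF'])).prod F'
  refine ⟨LinearEquiv.ofLinearMap G G' ?_ ?_⟩
  · apply LinearMap.ext
    rintro ⟨⟨k, hk⟩, x⟩
    apply Prod.ext
    · apply Subtype.ext
      change (k + a x) - a ((x - b (k + a x)) + b (k + a x)) = k
      simp
    · change (x - b (k + a x)) + b (k + a x) = x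
      simp
  · apply LinearMap.ext
    rintro ⟨⟨k, hk⟩, x⟩
    apply Prod.ext
    · apply Subtype.ext
      change (k + b x) - b ((x - a (k + b x)) + a (k + b x)) = k
      simp
    · change (x - a (k + b x)) + a (k + b x) = x
      simp

theorem proj_fst {R : Type u} [Ring R] {M P : Type v} [AddCommGroup M] [Module R M]
    [AddCommGroup P] [Module R P] (h : Module.Projective R (M × P)) : Module.Projective R M :=
  Module.Projective.of_split (LinearMap.inl R M P) (LinearMap.fst R M P) (by ext; simp)

/-- The kernel of `f × id`. -/
def kerProdEquiv {R : Type u} [Ring R] {M P G : Type v} [AddCommGroup M] [Module R M]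
    [AddCommGroup P] [Module R P] [AddCommGroup G] [Module R G] (f : G →ₗ[R] M) :
    LinearMap.ker f ≃ₗ[R] LinearMap.ker (f.prodMap (LinearMap.id : P →ₗ[R] P)) :=
  LinearEquiv.ofLinearMap
    ((LinearMap.inl R G P ∘ₗ (LinearMap.ker f).subtype).codRestrict _
      (fun z => by simp))
    ((LinearMap.fst R G P ∘ₗ (LinearMap.ker _).subtype).codRestrict _
      (fun z => by
        have := z.2
        rw [LinearMap.mem_ker] at this
        exact congrArg Prod.fst this))
    (by
      apply LinearMap.ext
      rintro ⟨⟨x, y⟩, h⟩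
      have : y = 0 := congrArg Prod.snd (LinearMap.mem_ker.1 h)
      subst this
      rfl)
    (by
      apply LinearMap.ext
      intro x
      rfl)

/-! ### Projective dimension -/

theorem PdLE.iso {A : Type u} [Ring A] : ∀ (n : ℕ) {K K' : Type v} [AddCommGroup K] [Module A K]
    [AddCommGroup K'] [Module A K'] (_ : K ≃ₗ[A] K') (_ : PdLE A n (ModuleCat.of A K)),
    PdLE A n (ModuleCat.of A K')
  | 0, K, K', _, _, _, _, e, h => by
      have h : Module.Projective A K := h
      exact (Module.Projective.of_equiv e : Module.Projective A K')
  | n + 1, K, K', _, _, _, _, e, h => by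
      obtain ⟨G, f, hG, hf, hk⟩ := h
      refine ⟨G, e.toLinearMap ∘ₗ f, hG, e.surjective.comp hf, ?_⟩
      refine PdLE.iso n (LinearEquiv.ofEq (LinearMap.ker f) _ ?_) hk
      ext x
      simp

theorem PdLE.prod {A : Type u} [Ring A] (n : ℕ) {K P : Type v} [AddCommGroup K] [Module A K]
    [AddCommGroup P] [Module A P] (hP : Module.Projective A P) (h : PdLE A n (ModuleCat.of A K)) :
    PdLE A n (ModuleCat.of A (K × P)) := by
  cases n with
  | zero =>
      have h : Module.Projective A K := h
      exact (inferInstance : Module.Projective A (K × P))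
  | succ n =>
      obtain ⟨G, f, hG, hf, hk⟩ := h
      refine ⟨ModuleCat.of A (G × P), f.prodMap LinearMap.id, ?_, ?_, ?_⟩
      · exact (inferInstance : Module.Projective A (G × P))
      · rintro ⟨x, y⟩
        obtain ⟨z, hz⟩ := hf x
        exact ⟨(z, y), Prod.ext hz rfl⟩
      · exact PdLE.iso n (kerProdEquiv f) hk

theorem PdLE.ker_projective {A : Type u} [Ring A] {M G : Type v} [AddCommGroup M] [Module A M]
    [AddCommGroup G] [Module A G] (hG : Module.Projective A G) (f : G →ₗ[A] M)
    (hf : Function.Surjective f) (h : PdLE A 1 (ModuleCat.of A M)) :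
    Module.Projective A (LinearMap.ker f) := by
  obtain ⟨G', f', hG', hf', hk⟩ := h
  have hk : Module.Projective A (LinearMap.ker f') := hk
  obtain ⟨e⟩ := schanuel hG hG' f f' hf hf'
  exact proj_fst (Module.Projective.of_equiv e.symm)

/-! ### The class of modules with vanishing Ext over `B` -/

def Good (B : Type u) [Ring B] (Z : Type v) [AddCommGroup Z] [Module B Z] : Prop :=
  ∃ C : ProjCx.{u, v} B, IsTotallyAcyclic C ∧ ∃ i : ℤ, Nonempty (Z ≃ₗ[B] LinearMap.ker (C.d i))

/-- All maps from the kernel of `p` to projectives extend. -/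
def ExtProp {B : Type u} [Ring B] {X Z : Type v} [AddCommGroup Z] [Module B Z]
    [AddCommGroup X] [Module B X] (p : X →ₗ[B] Z) : Prop :=
  ∀ (Q : Type v) [AddCommGroup Q] [Module B Q], Module.Projective B Q →
    ∀ φ : LinearMap.ker p →ₗ[B] Q, ∃ h : X →ₗ[B] Q, ∀ x : LinearMap.ker p, h x = φ x

theorem Good.cover {B : Type u} [Ring B] {Z : Type v} [AddCommGroup Z] [Module B Z]
    (h : Good.{u, v} B Z) : ∃ (X : Type v) (_ : AddCommGroup X) (_ : Module B X) (p : X →ₗ[B] Z),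
      Module.Projective B X ∧ Function.Surjective p ∧ Good.{u, v} B (LinearMap.ker p) ∧
      ExtProp p := by
  obtain ⟨C, hC, i, ⟨e⟩⟩ := h
  obtain ⟨j, rfl⟩ : ∃ j, i = j + 1 + 1 + 1 := ⟨i - 3, by ring⟩
  obtain ⟨hproj, hex, hhom⟩ := hC
  let d' : C.X (j + 1 + 1) →ₗ[B] LinearMap.ker (C.d (j + 1 + 1 + 1)) :=
    (C.d (j + 1 + 1)).codRestrict _ (fun x => by
      rw [← hex]; exact ⟨x, rfl⟩)
  have hker : LinearMap.ker (C.d (j + 1 + 1)) = LinearMap.ker (e.symm.toLinearMap ∘ₗ d') := by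
    ext x
    simp [d', LinearMap.codRestrict]
  refine ⟨C.X (j + 1 + 1), inferInstance, inferInstance, e.symm.toLinearMap ∘ₗ d', hproj _, ?_,
    ⟨C, ⟨hproj, hex, hhom⟩, j + 1 + 1, ⟨LinearEquiv.ofEq _ _ hker.symm⟩⟩, ?_⟩
  · apply e.symm.surjective.comp
    rintro ⟨x, hx⟩
    rw [← hex] at hx
    obtain ⟨y, rfl⟩ := hx
    exact ⟨y, rfl⟩
  · rw [ExtProp, ← hker]
    intro Q _ _ hQ φ
    let dd : C.X (j + 1) →ₗ[B] LinearMap.ker (C.d (j + 1 + 1)) :=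
      (C.d (j + 1)).codRestrict _ (fun x => by
        rw [← hex]; exact ⟨x, rfl⟩)
    obtain ⟨h, hh⟩ := hhom Q hQ j (φ ∘ₗ dd) (by
      ext x
      have : dd (C.d j x) = 0 := by
        apply Subtype.ext
        have : C.d j x ∈ LinearMap.ker (C.d (j + 1)) := by rw [← hex]; exact ⟨x, rfl⟩
        exact this
      simp [this])
    refine ⟨h, ?_⟩
    rintro ⟨x, hx⟩
    have hx' := hx
    rw [← hex] at hx'
    obtain ⟨y, rfl⟩ := hx'
    exact LinearMap.congr_fun hh y

def SG (B : Type u) [Ring B] (M : Type v) [AddCommGroup M] [Module B M] : Prop :=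
  ∃ (P X : Type v) (_ : AddCommGroup P) (_ : Module B P) (_ : AddCommGroup X) (_ : Module B X)
    (p : X →ₗ[B] (M × P)), Module.Projective B P ∧ Module.Projective B X ∧
      Function.Surjective p ∧ Good.{u, v} B (LinearMap.ker p) ∧ ExtProp p

theorem Good.iso {B : Type u} [Ring B] {Z Z' : Type v} [AddCommGroup Z] [Module B Z]
    [AddCommGroup Z'] [Module B Z'] (e : Z ≃ₗ[B] Z') (h : Good.{u, v} B Z) : Good.{u, v} B Z' := by
  obtain ⟨C, hC, i, ⟨e'⟩⟩ := h
  exact ⟨C, hC, i, ⟨e.symm.trans e'⟩⟩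

theorem ExtProp.of_eq {B : Type u} [Ring B] {X Z Z' : Type v} [AddCommGroup Z] [Module B Z]
    [AddCommGroup Z'] [Module B Z']
    [AddCommGroup X] [Module B X] {p : X →ₗ[B] Z} (hp : ExtProp p) (p' : X →ₗ[B] Z')
    (h : LinearMap.ker p = LinearMap.ker p') : ExtProp p' := by
  unfold ExtProp at *
  rw [← h]
  exact hp

/-- A module `Z × Y` with `Z` good and `Y` projective, isomorphic to `M × P`. -/
theorem SG.of_equiv {B : Type u} [Ring B] {M P Z Y : Type v} [AddCommGroup M] [Module B M]
    [AddCommGroup P] [Module B P] [AddCommGroup Z] [Module B Z] [AddCommGroup Y] [Module B Y]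
    (hP : Module.Projective B P) (hY : Module.Projective B Y) (hZ : Good.{u, v} B Z)
    (e : (Z × Y) ≃ₗ[B] (M × P)) : SG.{u, v} B M := by
  obtain ⟨X, _, _, p, hX, hp, hg, hext⟩ := hZ.cover
  have hk : LinearMap.ker (p.prodMap (LinearMap.id : Y →ₗ[B] Y)) =
    LinearMap.ker (e.toLinearMap ∘ₗ p.prodMap LinearMap.id) := by
      ext x; simp
  refine ⟨P, X × Y, inferInstance, inferInstance, inferInstance, inferInstance,
    e.toLinearMap ∘ₗ p.prodMap LinearMap.id, hP, inferInstance, ?_, ?_, ?_⟩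
  · apply e.surjective.comp
    rintro ⟨x, y⟩
    obtain ⟨z, hz⟩ := hp x
    exact ⟨(z, y), Prod.ext hz rfl⟩
  · exact hg.iso ((kerProdEquiv p).trans (LinearEquiv.ofEq _ _ hk))
  · refine ExtProp.of_eq (p := p.prodMap (LinearMap.id : Y →ₗ[B] Y)) ?_ _ hk
    intro Q _ _ hQ φ
    obtain ⟨h, hh⟩ := hext Q hQ (φ ∘ₗ (kerProdEquiv p).toLinearMap)
    refine ⟨h ∘ₗ LinearMap.fst B X Y, fun x => ?_⟩
    obtain ⟨z, rfl⟩ := (kerProdEquiv (P := Y) p).surjective x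
    exact hh z

theorem SG.syzygy {B : Type u} [Ring B] {M E : Type v} [AddCommGroup M] [Module B M]
    [AddCommGroup E] [Module B E] (h : SG.{u, v} B M) (hE : Module.Projective B E)
    (f : E →ₗ[B] M) (hf : Function.Surjective f) : SG.{u, v} B (LinearMap.ker f) := by
  obtain ⟨P, X, _, _, _, _, p, hP, hX, hp, hg, hext⟩ := h
  have hs : Function.Surjective (f.prodMap (LinearMap.id : P →ₗ[B] P)) := by
    rintro ⟨x, y⟩
    obtain ⟨z, hz⟩ := hf x
    exact ⟨(z, y), Prod.ext hz rfl⟩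
  obtain ⟨e⟩ := schanuel hX (inferInstance : Module.Projective B (E × P)) p
    (f.prodMap (LinearMap.id : P →ₗ[B] P)) hp hs
  exact SG.of_equiv hX (inferInstance : Module.Projective B (E × P)) hg
    (e.trans (LinearEquiv.prodCongr (kerProdEquiv f).symm (LinearEquiv.refl B X)))

/-- Extension along any kernel. -/
theorem ext_of_cover {B : Type u} [Ring B] {M E X Q : Type v} [AddCommGroup M] [Module B M]
    [AddCommGroup E] [Module B E] [AddCommGroup X] [Module B X] [AddCommGroup Q] [Module B Q]
    (hX : Module.Projective B X) (p : X →ₗ[B] M) (hp : Function.Surjective p) (hext : ExtProp p)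
    (hQ : Module.Projective B Q)
    (f : E →ₗ[B] M) (hf : Function.Surjective f) (φ : LinearMap.ker f →ₗ[B] Q) :
    ∃ h : E →ₗ[B] Q, ∀ x : LinearMap.ker f, h x = φ x := by
  obtain ⟨l, hl⟩ := Module.projective_lifting_property f p hf
  have hl' : ∀ x, f (l x) = p x := fun x => LinearMap.congr_fun hl x
  let l' : LinearMap.ker p →ₗ[B] LinearMap.ker f :=
    (l ∘ₗ (LinearMap.ker p).subtype).codRestrict _ (fun x => by simp [hl'])
  obtain ⟨h, hh⟩ := hext Q hQ (φ ∘ₗ l')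
  let s : (LinearMap.ker f × X) →ₗ[B] E := (LinearMap.ker f).subtype.coprod l
  let t : (LinearMap.ker f × X) →ₗ[B] Q := φ.coprod h
  have hs : Function.Surjective s := fun y => by
    obtain ⟨x, hx⟩ := hp (f y)
    refine ⟨(⟨y - l x, by simp [hl', hx]⟩, x), by simp [s]⟩
  have hst : LinearMap.ker s ≤ LinearMap.ker t := by
    rintro ⟨⟨k, hk⟩, x⟩ hz
    have hz : k + l x = 0 := by simpa [s] using hz
    have hx : p x = 0 := by
      have := congrArg f hz
      simpa [hl', LinearMap.mem_ker.1 hk] using this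
    have h1 := hh ⟨x, hx⟩
    have h2 : (⟨k, hk⟩ : LinearMap.ker f) = - l' ⟨x, hx⟩ := by
      apply Subtype.ext
      exact eq_neg_of_add_eq_zero_left hz
    have h1 : h x = φ (l' ⟨x, hx⟩) := h1
    simp [t, h2, h1]
  refine ⟨(LinearMap.ker s).liftQ t hst ∘ₗ (s.quotKerEquivOfSurjective hs).symm.toLinearMap, ?_⟩
  intro x
  have : (s.quotKerEquivOfSurjective hs).symm x.1 = (LinearMap.ker s).mkQ (x, 0) := by
    rw [LinearEquiv.symm_apply_eq]
    simp [s]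
  simp [this, t]

theorem SG.ext {B : Type u} [Ring B] {M E Q : Type v} [AddCommGroup M] [Module B M]
    [AddCommGroup E] [Module B E] [AddCommGroup Q] [Module B Q] (h : SG.{u, v} B M)
    (hQ : Module.Projective B Q)
    (f : E →ₗ[B] M) (hf : Function.Surjective f) (φ : LinearMap.ker f →ₗ[B] Q) :
    ∃ h : E →ₗ[B] Q, ∀ x : LinearMap.ker f, h x = φ x := by
  obtain ⟨P, X, _, _, _, _, p, hP, hX, hp, hg, hext⟩ := h
  have hs : Function.Surjective (f.prodMap (LinearMap.id : P →ₗ[B] P)) := by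
    rintro ⟨x, y⟩
    obtain ⟨z, hz⟩ := hf x
    exact ⟨(z, y), Prod.ext hz rfl⟩
  obtain ⟨h, hh⟩ := ext_of_cover hX p hp hext hQ _ hs (φ ∘ₗ (kerProdEquiv f).symm.toLinearMap)
  refine ⟨h ∘ₗ LinearMap.inl B E P, fun x => ?_⟩
  have := hh (kerProdEquiv f x)
  simp only [LinearMap.comp_apply, LinearEquiv.coe_coe, LinearEquiv.symm_apply_apply] at this
  exact this

/-! ### Reduction modulo `ω` -/

/-- `A`-linear maps between `B`-modules are `B`-linear. -/
def toB {A B : Type u} [Ring A] [Ring B] (π : A →+* B) (hπ : Function.Surjective π)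
    {V W : Type*} [AddCommGroup V] [Module A V] [Module B V] [AddCommGroup W] [Module A W]
    [Module B W] (hV : ∀ (x : A) (m : V), x • m = π x • m)
    (hW : ∀ (x : A) (m : W), x • m = π x • m) (f : V →ₗ[A] W) : V →ₗ[B] W :=
  { toFun := f
    map_add' := f.map_add
    map_smul' := fun b x => by
      obtain ⟨a, rfl⟩ := hπ b
      simp [← hV, ← hW] }

def toA {A B : Type u} [Ring A] [Ring B] (π : A →+* B)
    {V W : Type*} [AddCommGroup V] [Module A V] [Module B V] [AddCommGroup W] [Module A W]
    [Module B W] (hV : ∀ (x : A) (m : V), x • m = π x • m)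
    (hW : ∀ (x : A) (m : W), x • m = π x • m) (f : V →ₗ[B] W) : V →ₗ[A] W :=
  { toFun := f
    map_add' := f.map_add
    map_smul' := fun a x => by
      simp [hV, hW] }

theorem exists_bar {A : Type u} [Ring A] (ω : A) (σ : A ≃+* A)
    (hσ : ∀ a : A, ω * a = σ a * ω)
    {B : Type u} [Ring B] (π : A →+* B) (hπ : Function.Surjective π)
    (hker : ∀ x : A, π x = 0 ↔ ∃ a : A, x = a * ω)
    (V : Type v) [AddCommGroup V] [Module A V] (hV : Module.Projective A V) :
    ∃ (E : Type v) (_ : AddCommGroup E) (_ : Module A E) (_ : Module B E) (q : V →ₗ[A] E),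
      (∀ (x : A) (m : E), x • m = π x • m) ∧ Function.Surjective q ∧
      (∀ v, q v = 0 ↔ ∃ y, v = ω • y) ∧ Module.Projective B E := by
  let S : Submodule A V :=
    { carrier := {v | ∃ y, v = ω • y}
      add_mem' := by
        rintro _ _ ⟨x, rfl⟩ ⟨y, rfl⟩
        exact ⟨x + y, by simp⟩
      zero_mem' := ⟨0, by simp⟩
      smul_mem' := by
        rintro a _ ⟨y, rfl⟩
        refine ⟨σ.symm a • y, ?_⟩
        rw [smul_smul, smul_smul, hσ]
        simp }
  have hkill : ∀ (a : A) (m : V ⧸ S), π a = 0 → a • m = 0 := by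
    intro a m ha
    obtain ⟨v, rfl⟩ := S.mkQ_surjective m
    obtain ⟨c, rfl⟩ := (hker a).1 ha
    rw [mul_smul, ← map_smul S.mkQ]
    have : S.mkQ (ω • v) = 0 := by
      rw [Submodule.mkQ_apply, Submodule.Quotient.mk_eq_zero]
      exact ⟨v, rfl⟩
    rw [this, smul_zero]
  let : SMul B (V ⧸ S) := ⟨fun b m => Function.surjInv hπ b • m⟩
  have hs : ∀ (x : A) (m : V ⧸ S), π x • m = x • m := by
    intro x m
    have h := hkill (Function.surjInv hπ (π x) - x) m
      (by rw [map_sub, Function.surjInv_eq hπ, sub_self])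
    rw [sub_smul, sub_eq_zero] at h
    exact h
  let iB : Module B (V ⧸ S) := Function.Surjective.moduleLeft π hπ hs
  have hs' : ∀ (x : A) (m : V ⧸ S), x • m = π x • m := fun x m => (hs x m).symm
  refine ⟨V ⧸ S, inferInstance, inferInstance, iB, S.mkQ, hs', S.mkQ_surjective, ?_, ?_⟩
  · intro v
    rw [Submodule.mkQ_apply, Submodule.Quotient.mk_eq_zero]
    rfl
  · apply Module.Projective.of_lifting_property''
    intro f hf
    let : Module A ((V ⧸ S) →₀ B) := Module.compHom _ π
    have hF : ∀ (x : A) (m : (V ⧸ S) →₀ B), x • m = π x • m := fun _ _ => rfl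
    obtain ⟨g, hg⟩ := Module.projective_lifting_property (toA π hF hs' f) S.mkQ hf
    have hle : S ≤ LinearMap.ker g := by
      rintro _ ⟨y, rfl⟩
      have : π ω = 0 := (hker ω).2 ⟨1, by simp⟩
      rw [LinearMap.mem_ker, map_smul, hF, this, zero_smul]
    refine ⟨toB π hπ hs' hF (S.liftQ g hle), ?_⟩
    apply LinearMap.ext
    intro x
    obtain ⟨v, rfl⟩ := S.mkQ_surjective x
    exact LinearMap.congr_fun hg v

/-- `ω` is regular on projective modules. -/
theorem omega_regular {A : Type u} [Ring A] (ω : A) (hreg' : ∀ a : A, ω * a = 0 → a = 0)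
    {V : Type v} [AddCommGroup V] [Module A V] (hV : Module.Projective A V) (v : V)
    (h : ω • v = 0) : v = 0 := by
  obtain ⟨s, hs⟩ := hV.out
  have h1 : ω • s v = 0 := by rw [← map_smul, h, map_zero]
  have h2 : s v = 0 := by
    ext x
    have := DFunLike.congr_fun h1 x
    exact hreg' _ this
  rw [← hs v, h2, map_zero]

theorem sigma_omega {A : Type u} [Ring A] (ω : A) (σ : A ≃+* A)
    (hσ : ∀ a : A, ω * a = σ a * ω) (hreg : ∀ a : A, a * ω = 0 → a = 0) : σ ω = ω := by
  have := hreg (σ ω - ω) (by rw [sub_mul, ← hσ, sub_self])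
  exact sub_eq_zero.1 this

/-- Multiplication by `ω` as a linear map to the twist. -/
def omegaMap {A : Type u} [Ring A] (ω : A) (σ : A ≃+* A)
    (hσ : ∀ a : A, ω * a = σ a * ω) (V : Type v) [AddCommGroup V] [Module A V] :
    V →ₗ[A] Tw σ V :=
  { toFun := fun v => Tw.mk σ V (ω • v)
    map_add' := fun x y => by simp
    map_smul' := fun a x => by
      simp only [RingHom.id_apply, Tw.smul_mk, smul_smul, hσ] }

/-- Functoriality of the twist. -/
def twMap {A : Type u} [Ring A] (σ : A ≃+* A) {V W : Type v} [AddCommGroup V] [Module A V]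
    [AddCommGroup W] [Module A W] (f : V →ₗ[A] W) : Tw σ V →ₗ[A] Tw σ W :=
  { toFun := fun v => Tw.mk σ W (f ((Tw.mk σ V).symm v))
    map_add' := fun x y => by simp
    map_smul' := fun a x => by simp [Tw.symm_smul, Tw.smul_mk] }

theorem exists_s {A : Type u} [Ring A] (ω : A) (σ : A ≃+* A)
    (hσ : ∀ a : A, ω * a = σ a * ω)
    {M G₀ G₁ : Type v} [AddCommGroup M] [Module A M]
    [AddCommGroup G₀] [Module A G₀] [AddCommGroup G₁] [Module A G₁]
    (hM : ∀ m : M, ω • m = 0)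
    (hG₀ : Module.Projective A G₀) (f : G₀ →ₗ[A] M)
    (g : G₁ →ₗ[A] LinearMap.ker f) (hg : Function.Surjective g) :
    ∃ s : G₀ →ₗ[A] Tw σ G₁, ∀ y : G₀, ((g ((Tw.mk σ G₁).symm (s y)) : LinearMap.ker f) : G₀)
      = ω • y := by
  let w : G₀ →ₗ[A] Tw σ (LinearMap.ker f) :=
    { toFun := fun v => Tw.mk σ _ ⟨ω • v, by simp [hM]⟩
      map_add' := fun x y => by
        rw [← map_add]
        congr 1
        apply Subtype.ext
        simp
      map_smul' := fun a x => by
        simp only [RingHom.id_apply, Tw.smul_mk]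
        congr 1
        apply Subtype.ext
        simp only [smul_smul, hσ, SetLike.mk_smul_mk] }
  obtain ⟨s, hs⟩ := Module.projective_lifting_property (twMap σ g) w hg
  refine ⟨s, fun y => ?_⟩
  have := LinearMap.congr_fun hs y
  exact congrArg Subtype.val this

/-- The case `n = 2`. -/
theorem case_two {A : Type u} [Ring A] (ω : A) (σ : A ≃+* A)
    (hσ : ∀ a : A, ω * a = σ a * ω)
    (hreg : ∀ a : A, a * ω = 0 → a = 0) (hreg' : ∀ a : A, ω * a = 0 → a = 0)
    {B : Type u} [Ring B] (π : A →+* B) (hπ : Function.Surjective π)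
    (hker : ∀ x : A, π x = 0 ↔ ∃ a : A, x = a * ω)
    {M G₀ G₁ : Type v} [AddCommGroup M] [Module A M] [Module B M]
    (hcompat : ∀ (x : A) (m : M), x • m = π x • m) (hSG : SG.{u, v} B M)
    [AddCommGroup G₀] [Module A G₀] [AddCommGroup G₁] [Module A G₁]
    (hG₀ : Module.Projective A G₀) (hG₁ : Module.Projective A G₁)
    (f : G₀ →ₗ[A] M) (hf : Function.Surjective f)
    (g : G₁ →ₗ[A] LinearMap.ker f) (hg : Function.Surjective g)
    (hK : Module.Projective A (LinearMap.ker g)) : Module.Projective A (LinearMap.ker f) := by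
  have hπω : π ω = 0 := (hker ω).2 ⟨1, by simp⟩
  have hM : ∀ m : M, ω • m = 0 := fun m => by rw [hcompat, hπω, zero_smul]
  have hσω := sigma_omega ω σ hσ hreg
  obtain ⟨s, hs⟩ := exists_s ω σ hσ hM hG₀ f g hg
  -- `t : G₁ → Tw K₂`
  let t₀ : G₁ →ₗ[A] Tw σ G₁ := omegaMap ω σ hσ G₁ - s ∘ₗ (LinearMap.ker f).subtype ∘ₗ g
  have ht₀ : ∀ x, (Tw.mk σ G₁).symm (t₀ x) = ω • x - (Tw.mk σ G₁).symm (s (g x)) := fun _ => rfl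
  have ht₀k : ∀ x, g ((Tw.mk σ G₁).symm (t₀ x)) = 0 := fun x => by
    apply Subtype.ext
    rw [ht₀, map_sub, Submodule.coe_sub, hs, map_smul]
    simp
  let t : G₁ →ₗ[A] Tw σ (LinearMap.ker g) :=
    { toFun := fun x => Tw.mk σ _ ⟨(Tw.mk σ G₁).symm (t₀ x), ht₀k x⟩
      map_add' := fun x y => by
        rw [← map_add]
        congr 1
        apply Subtype.ext
        simp
      map_smul' := fun a x => by
        simp only [RingHom.id_apply, Tw.smul_mk]
        congr 1
        apply Subtype.ext
        simp [Tw.symm_smul] }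
  have htK : ∀ k : LinearMap.ker g, t k = Tw.mk σ _ (ω • k) := fun k => by
    change Tw.mk σ _ _ = _
    congr 1
    apply Subtype.ext
    change (Tw.mk σ G₁).symm (t₀ k) = ω • (k : G₁)
    rw [ht₀, LinearMap.mem_ker.1 k.2]
    simp
  have hts : ∀ y : G₀, t ((Tw.mk σ G₁).symm (s y)) = 0 := fun y => by
    change Tw.mk σ _ _ = _
    rw [map_eq_zero_iff _ (Tw.mk σ _).injective]
    apply Subtype.ext
    change (Tw.mk σ G₁).symm (t₀ _) = 0
    rw [ht₀, hs, map_smul, Tw.symm_smul, hσω, sub_self]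
  have hTK := Tw.projective σ _ hK
  obtain ⟨Q, _, _, _, q, hQc, hqs, hq, hQ⟩ := exists_bar ω σ hσ π hπ hker _ hTK
  have hωTw : ∀ (k : LinearMap.ker g), Tw.mk σ _ (ω • k) = ω • Tw.mk σ _ k := fun k => by
    rw [Tw.smul_mk, hσω]
  obtain ⟨E, _, _, _, qE, hEc, hqEs, hqE, hE⟩ := exists_bar ω σ hσ π hπ hker G₀ hG₀
  -- the map E → M
  have hle : LinearMap.ker qE ≤ LinearMap.ker f := fun x hx => by
    obtain ⟨y, rfl⟩ := (hqE x).1 hx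
    simp [hM]
  let fE₀ : E →ₗ[A] M := (LinearMap.ker qE).liftQ f hle ∘ₗ
    (qE.quotKerEquivOfSurjective hqEs).symm.toLinearMap
  have hfE₀ : ∀ y, fE₀ (qE y) = f y := fun y => by
    have : (qE.quotKerEquivOfSurjective hqEs).symm (qE y) = (LinearMap.ker qE).mkQ y := by
      rw [LinearEquiv.symm_apply_eq]; simp
    simp [fE₀, this]
  let fE : E →ₗ[B] M := toB π hπ hEc hcompat fE₀
  have hfE : ∀ y, fE (qE y) = f y := hfE₀
  have hfEs : Function.Surjective fE := fun m => by
    obtain ⟨y, rfl⟩ := hf m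
    exact ⟨qE y, hfE y⟩
  -- the map ker fE → Q
  let : Module A (LinearMap.ker fE) := Module.compHom _ π
  have hJc : ∀ (x : A) (m : LinearMap.ker fE), x • m = π x • m := fun _ _ => rfl
  let r : G₁ →ₗ[A] LinearMap.ker fE :=
    { toFun := fun x => ⟨qE (g x), by rw [LinearMap.mem_ker, hfE]; exact (g x).2⟩
      map_add' := fun x y => by apply Subtype.ext; simp
      map_smul' := fun a x => by
        apply Subtype.ext
        rw [RingHom.id_apply, hJc, Submodule.coe_smul, ← hEc]
        simp }
  have hrs : Function.Surjective r := by
    rintro ⟨z, hz⟩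
    obtain ⟨y, rfl⟩ := hqEs z
    obtain ⟨x, hx⟩ := hg ⟨y, by rw [LinearMap.mem_ker, ← hfE]; exact hz⟩
    exact ⟨x, Subtype.ext (by simp [r, hx])⟩
  have hrle : LinearMap.ker r ≤ LinearMap.ker (q ∘ₗ t) := fun x hx => by
    have hx : qE (g x) = 0 := congrArg Subtype.val (LinearMap.mem_ker.1 hx)
    obtain ⟨y, hy⟩ := (hqE _).1 hx
    have hk : x - (Tw.mk σ G₁).symm (s y) ∈ LinearMap.ker g := by
      rw [LinearMap.mem_ker, map_sub, sub_eq_zero]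
      apply Subtype.ext
      rw [hs, hy]
    have h1 := htK ⟨_, hk⟩
    rw [map_sub, hts, sub_zero] at h1
    rw [LinearMap.mem_ker, LinearMap.comp_apply, h1, hq]
    exact ⟨_, hωTw _⟩
  let φ₀ : LinearMap.ker fE →ₗ[A] Q := (LinearMap.ker r).liftQ (q ∘ₗ t) hrle ∘ₗ
    (r.quotKerEquivOfSurjective hrs).symm.toLinearMap
  have hφ₀ : ∀ x, φ₀ (r x) = q (t x) := fun y => by
    have : (r.quotKerEquivOfSurjective hrs).symm (r y) = (LinearMap.ker r).mkQ y := by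
      rw [LinearEquiv.symm_apply_eq]; simp
    simp [φ₀, this]
  obtain ⟨h, hh⟩ := hSG.ext hQ fE hfEs (toB π hπ hJc hQc φ₀)
  obtain ⟨l, hl⟩ := Module.projective_lifting_property q (toA π hEc hQc h ∘ₗ qE) hqs
  have hl' : ∀ y, q (l y) = h (qE y) := fun y => LinearMap.congr_fun hl y
  let T : G₁ →ₗ[A] Tw σ (LinearMap.ker g) := t - l ∘ₗ (LinearMap.ker f).subtype ∘ₗ g
  have hTq : ∀ x, T x ∈ LinearMap.range (omegaMap ω σ hσ (LinearMap.ker g)) := fun x => by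
    have h0 : q (T x) = 0 := by
      have h1 : h (qE (g x)) = q (t x) := (hh (r x)).trans (hφ₀ x)
      simp [T, hl', h1]
    obtain ⟨y, hy⟩ := (hq _).1 h0
    refine ⟨(Tw.mk σ _).symm y, ?_⟩
    rw [hy]
    exact hωTw _
  have hinj : Function.Injective (omegaMap ω σ hσ (LinearMap.ker g)) := by
    rw [injective_iff_map_eq_zero]
    intro k hk
    exact omega_regular ω hreg' hK k hk
  let R : G₁ →ₗ[A] LinearMap.ker g :=
    (LinearEquiv.ofInjective _ hinj).symm.toLinearMap ∘ₗ T.codRestrict _ hTq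
  have hR : ∀ k : LinearMap.ker g, R k = k := fun k => by
    change (LinearEquiv.ofInjective _ hinj).symm _ = k
    rw [LinearEquiv.symm_apply_eq]
    apply Subtype.ext
    change T k = Tw.mk σ _ (ω • k)
    rw [← htK]
    simp [T, LinearMap.mem_ker.1 k.2]
  -- section
  have hgle : LinearMap.ker g ≤ LinearMap.ker (LinearMap.id - (LinearMap.ker g).subtype ∘ₗ R) := by
    intro k hk
    have := hR ⟨k, hk⟩
    simp only at this
    simp [this]
  refine Module.Projective.of_split ((LinearMap.ker g).liftQ _ hgle ∘ₗ
    (g.quotKerEquivOfSurjective hg).symm.toLinearMap) g ?_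
  apply LinearMap.ext
  intro z
  obtain ⟨x, rfl⟩ := hg z
  have : (g.quotKerEquivOfSurjective hg).symm (g x) = (LinearMap.ker g).mkQ x := by
    rw [LinearEquiv.symm_apply_eq]; simp
  simp [this]

theorem main_induction {A : Type u} [Ring A] (ω : A) (σ : A ≃+* A)
    (hσ : ∀ a : A, ω * a = σ a * ω)
    (hreg : ∀ a : A, a * ω = 0 → a = 0) (hreg' : ∀ a : A, ω * a = 0 → a = 0)
    {B : Type u} [Ring B] (π : A →+* B) (hπ : Function.Surjective π)
    (hker : ∀ x : A, π x = 0 ↔ ∃ a : A, x = a * ω) (n : ℕ) :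
    ∀ {M : Type v} [AddCommGroup M] [Module A M] [Module B M]
    (_ : ∀ (x : A) (m : M), x • m = π x • m) (_ : SG.{u, v} B M)
    (_ : PdLE A (n + 1) (ModuleCat.of A M)), PdLE A 1 (ModuleCat.of A M) := by
  induction n with
  | zero => intro M _ _ _ _ _ h; exact h
  | succ n ih =>
    intro M _ _ _ hcompat hSG h
    obtain ⟨G₀, f, hG₀, hf, G₁, g, hG₁, hg, hK⟩ := h
    refine ⟨G₀, f, hG₀, hf, ?_⟩
    change Module.Projective A (LinearMap.ker f)
    change G₀ →ₗ[A] M at f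
    change G₁ →ₗ[A] LinearMap.ker f at g
    refine case_two ω σ hσ hreg hreg' π hπ hker hcompat hSG hG₀ hG₁ f hf g hg ?_
    cases n with
    | zero => exact hK
    | succ n =>
    have hπω : π ω = 0 := (hker ω).2 ⟨1, by simp⟩
    have hM : ∀ m : M, ω • m = 0 := fun m => by rw [hcompat, hπω, zero_smul]
    obtain ⟨s, hs⟩ := exists_s ω σ hσ hM hG₀ f g hg
    obtain ⟨E, _, _, _, qE, hEc, hqEs, hqE, hE⟩ := exists_bar ω σ hσ π hπ hker G₀ hG₀
    have hle : LinearMap.ker qE ≤ LinearMap.ker f := fun x hx => by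
      obtain ⟨y, rfl⟩ := (hqE x).1 hx
      simp [hM]
    let fE₀ : E →ₗ[A] M := (LinearMap.ker qE).liftQ f hle ∘ₗ
      (qE.quotKerEquivOfSurjective hqEs).symm.toLinearMap
    have hfE₀ : ∀ y, fE₀ (qE y) = f y := fun y => by
      have : (qE.quotKerEquivOfSurjective hqEs).symm (qE y) = (LinearMap.ker qE).mkQ y := by
        rw [LinearEquiv.symm_apply_eq]; simp
      simp [fE₀, this]
    let fE : E →ₗ[B] M := toB π hπ hEc hcompat fE₀
    have hfE : ∀ y, fE (qE y) = f y := hfE₀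
    have hfEs : Function.Surjective fE := fun m => by
      obtain ⟨y, rfl⟩ := hf m
      exact ⟨qE y, hfE y⟩
    let : Module A (LinearMap.ker fE) := Module.compHom _ π
    have hJc : ∀ (x : A) (m : LinearMap.ker fE), x • m = π x • m := fun _ _ => rfl
    let r : G₁ →ₗ[A] LinearMap.ker fE :=
      { toFun := fun x => ⟨qE (g x), by rw [LinearMap.mem_ker, hfE]; exact (g x).2⟩
        map_add' := fun x y => by apply Subtype.ext; simp
        map_smul' := fun a x => by
          apply Subtype.ext
          rw [RingHom.id_apply, hJc, Submodule.coe_smul, ← hEc]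
          simp }
    have hrs : Function.Surjective r := by
      rintro ⟨z, hz⟩
      obtain ⟨y, rfl⟩ := hqEs z
      obtain ⟨x, hx⟩ := hg ⟨y, by rw [LinearMap.mem_ker, ← hfE]; exact hz⟩
      exact ⟨x, Subtype.ext (by simp [r, hx])⟩
    have hr0 : ∀ x, r x = 0 ↔ ∃ y, (g x : G₀) = ω • y := fun x => by
      rw [← hqE]
      exact Subtype.ext_iff
    -- the kernel of `r`
    let c : (LinearMap.ker g × Tw σ.symm G₀) →ₗ[A] LinearMap.ker r :=
      { toFun := fun z => ⟨z.1 + (Tw.mk σ G₁).symm (s ((Tw.mk σ.symm G₀).symm z.2)), by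
          rw [LinearMap.mem_ker, hr0]
          refine ⟨(Tw.mk σ.symm G₀).symm z.2, ?_⟩
          rw [map_add, Submodule.coe_add, hs, LinearMap.mem_ker.1 z.1.2]
          simp⟩
        map_add' := fun x y => by
          apply Subtype.ext
          simp
          abel
        map_smul' := fun a x => by
          apply Subtype.ext
          simp [Tw.symm_smul] }
    have hgc : ∀ z, (g (c z) : G₀) = ω • (Tw.mk σ.symm G₀).symm z.2 := fun z => by
      change (g (z.1 + (Tw.mk σ G₁).symm (s ((Tw.mk σ.symm G₀).symm z.2))) : G₀) = _
      rw [map_add, Submodule.coe_add, hs, LinearMap.mem_ker.1 z.1.2]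
      simp
    have hcb : Function.Bijective c := by
      constructor
      · rw [injective_iff_map_eq_zero]
        rintro ⟨k, y⟩ hz
        have h1 := hgc (k, y)
        rw [hz] at h1
        have h2 : (Tw.mk σ.symm G₀).symm y = 0 :=
          omega_regular ω hreg' hG₀ _ (by simpa using h1.symm)
        have h3 : y = 0 := h2
        subst h3
        have h4 : (k : G₁) + (Tw.mk σ G₁).symm (s ((Tw.mk σ.symm G₀).symm 0)) = 0 :=
          congrArg Subtype.val hz
        simp at h4
        simp [h4]
      · rintro ⟨x, hx⟩
        obtain ⟨y, hy⟩ := (hr0 x).1 hx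
        have hk : x - (Tw.mk σ G₁).symm (s y) ∈ LinearMap.ker g := by
          rw [LinearMap.mem_ker, map_sub, sub_eq_zero]
          apply Subtype.ext
          rw [hs, hy]
        refine ⟨(⟨_, hk⟩, Tw.mk σ.symm G₀ y), ?_⟩
        apply Subtype.ext
        simp [c]
    let e := LinearEquiv.ofBijective c hcb
    have hpdJ : PdLE A (n + 1 + 1) (ModuleCat.of A (LinearMap.ker fE)) :=
      ⟨G₁, r, hG₁, hrs, PdLE.iso _ e (PdLE.prod _ (Tw.projective _ _ hG₀) hK)⟩
    have h1 := ih hJc (hSG.syzygy hE fE hfEs) hpdJ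
    have h2 := PdLE.ker_projective hG₁ r hrs h1
    exact proj_fst (Module.Projective.of_equiv e.symm)

end Helpers

theorem pd_eq_one_of_gorensteinProjective_quotient
    {A : Type u} [Ring A] (ω : A) (σ : A ≃+* A)
    (hσ : ∀ a : A, ω * a = σ a * ω)
    (hreg : ∀ a : A, a * ω = 0 → a = 0) (hreg' : ∀ a : A, ω * a = 0 → a = 0)
    {B : Type u} [Ring B] (π : A →+* B) (hπ : Function.Surjective π)
    (hker : ∀ x : A, π x = 0 ↔ ∃ a : A, x = a * ω)
    {N : Type v} [AddCommGroup N] [Module A N] [Module B N] [Nontrivial N]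
    (hcompat : ∀ (x : A) (m : N), x • m = π x • m)
    (hGP : IsGorensteinProjective B N)
    (hfin : ∃ n : ℕ, PdLE A n (ModuleCat.of A N)) :
    PdLE A 1 (ModuleCat.of A N) ∧ ¬ PdLE A 0 (ModuleCat.of A N) := by
  have hπω : π ω = 0 := (hker ω).2 ⟨1, by simp⟩
  have hN : ∀ m : N, ω • m = 0 := fun m => by rw [hcompat, hπω, zero_smul]
  have h0 : ¬ PdLE A 0 (ModuleCat.of A N) := by
    intro h
    have h : Module.Projective A N := h
    obtain ⟨x, hx⟩ := exists_ne (0 : N)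
    exact hx (omega_regular ω hreg' h x (hN x))
  refine ⟨?_, h0⟩
  obtain ⟨n, hn⟩ := hfin
  cases n with
  | zero => exact absurd hn h0
  | succ n =>
    obtain ⟨C, hC, he⟩ := hGP
    have hGood : Good.{u, v} B N := ⟨C, hC, 0, he⟩
    have hSG : SG.{u, v} B N :=
      SG.of_equiv (P := PUnit.{v + 1}) (Y := PUnit.{v + 1}) inferInstance inferInstance hGood
        (LinearEquiv.refl B _)
    exact main_induction ω σ hσ hreg hreg' π hπ hker n hcompat hSG hn
end

section
/- Let X = (X⁰, X¹; d⁰, d¹) be a matrix factorization (both Xⁱ finitely generated projective A-modules). Then the induced complex of Ā-modules with components the reductions X̄⁰ = X⁰/ωX⁰, X̄¹, twist-reductions of σ-twists, and differentials induced by d⁰ and d¹, extended 2-periodically up to twist, is acyclic; in particular coker(d⁰) is isomorphic to the kernel of the induced map overline(ᵗX⁰) → overline(ᵗX¹), and Cok⁰(X) is a totally reflexive Ā-module of projective dimension at most 1 over A. -/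
/-!
STATEMENT 18: Let `X = (X⁰, X¹; d⁰, d¹)` be a matrix factorization of `ω` (both
components finitely generated projective).  Then the induced `2`-periodic (up to
twist) complex of `Ā`-modules `⋯ → X̄⁰ → X̄¹ → ᵗX̄⁰ → ᵗX̄¹ → ⋯` is acyclic: exactness
is expressed by the two conditions (taking into account `ωX¹ ⊆ im d⁰` the first one
also says that `Cok⁰(X) = coker d⁰` maps isomorphically onto the kernel of the
induced map `ᵗX̄⁰ → ᵗX̄¹`).  Moreover `Cok⁰(X)` (here an abstract `B = Ā`-module `N`
with `A`-linear presentation `c : X¹ → N`, `ker c = im d⁰`) is a totally reflexive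
`Ā`-module of projective dimension at most `1` over `A`.
-/

universe u v

/-- A module factorization `X = (X⁰, X¹; d⁰, d¹)` of `ω` over `A`: `d⁰ : X⁰ → X¹` is
`A`-linear and `d¹ : X¹ → ᵗ(X⁰)` is `A`-linear, i.e. `d¹ : X¹ → X⁰` is
`σ`-semilinear, with `d¹ ∘ d⁰ = ω_{X⁰}` and `ᵗ(d⁰) ∘ d¹ = ω_{X¹}`. -/
structure MFact (A : Type u) [Ring A] (ω : A) (σ : A ≃+* A) : Type (max u (v + 1)) where
  X0 : ModuleCat.{v} A
  X1 : ModuleCat.{v} A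
  d0 : X0 →ₗ[A] X1
  d1 : X1 →ₛₗ[(σ : A →+* A)] X0
  comp01 : ∀ x : X0, d1 (d0 x) = ω • x
  comp10 : ∀ x : X1, d0 (d1 x) = ω • x

variable {A : Type u} [Ring A] {ω : A} {σ : A ≃+* A}

/-- A morphism of module factorizations. -/
@[ext] structure MFactHom (X Y : MFact.{u, v} A ω σ) where
  f0 : X.X0 →ₗ[A] Y.X0
  f1 : X.X1 →ₗ[A] Y.X1
  comm0 : ∀ x : X.X0, f1 (X.d0 x) = Y.d0 (f0 x)
  comm1 : ∀ x : X.X1, f0 (X.d1 x) = Y.d1 (f1 x)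

/-- Composition of morphisms of module factorizations. -/
def MFactHom.comp {X Y Z : MFact.{u, v} A ω σ} (g : MFactHom Y Z) (f : MFactHom X Y) :
    MFactHom X Z where
  f0 := g.f0 ∘ₗ f.f0
  f1 := g.f1 ∘ₗ f.f1
  comm0 := fun x => by
    simp only [LinearMap.comp_apply, f.comm0 x, g.comm0 (f.f0 x)]
  comm1 := fun x => by
    simp only [LinearMap.comp_apply, f.comm1 x, g.comm1 (f.f1 x)]

variable (ω σ)

/-- The trivial module factorization `θ⁰(M) = (M, M; Id_M, ω_M)`. -/
def theta0 (hσ : ∀ a : A, ω * a = σ a * ω)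
    (M : Type v) [AddCommGroup M] [Module A M] : MFact.{u, v} A ω σ where
  X0 := ModuleCat.of A M
  X1 := ModuleCat.of A M
  d0 := LinearMap.id
  d1 :=
    { toFun := fun m => ω • m
      map_add' := fun x y => smul_add ω x y
      map_smul' := fun a m => by
        simp only [RingHom.coe_coe]
        rw [smul_smul, smul_smul, hσ] }
  comp01 := fun x => rfl
  comp10 := fun x => rfl
/-- `N` is a totally reflexive `R`-module: a cocycle of a locally finite (finitely
generated components) totally acyclic complex of projective `R`-modules. -/
def IsTotallyReflexive (R : Type u) [Ring R]
    (N : Type v) [AddCommGroup N] [Module R N] : Prop :=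
  ∃ C : ProjCx.{u, v} R, IsTotallyAcyclic C ∧ (∀ i, Module.Finite R (C.X i)) ∧
    Nonempty (N ≃ₗ[R] LinearMap.ker (C.d 0))

section Helpers

lemma omega_inj {A : Type*} [Ring A] {ω : A} (hreg' : ∀ a : A, ω * a = 0 → a = 0)
    {M : Type*} [AddCommGroup M] [Module A M] (hP : Module.Projective A M)
    (x : M) (hx : ω • x = 0) : x = 0 := by
  obtain ⟨s, hs⟩ := hP.out
  have h : s x = 0 := by
    ext m
    apply hreg'
    have := congrArg (fun f => f m) (s.map_smul ω x)
    simpa [hx] using this.symm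
  have := hs x
  rw [h] at this
  simpa using this.symm

lemma exists_red {A : Type u} [Ring A] (ω : A) (σ : A ≃+* A)
    (hσ : ∀ a : A, ω * a = σ a * ω)
    {B : Type u} [Ring B] (π : A →+* B) (hπ : Function.Surjective π)
    (hker : ∀ x : A, π x = 0 ↔ ∃ a : A, x = a * ω)
    (M : Type v) [AddCommGroup M] [Module A M] :
    ∃ (Mb : ModuleCat.{v} B) (q : M →ₛₗ[π] Mb), Function.Surjective q ∧
      ∀ x, q x = 0 ↔ ∃ y, x = ω • y := by
  let S : Submodule A M :=
    { carrier := {x | ∃ y, x = ω • y}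
      add_mem' := by
        rintro _ _ ⟨a, rfl⟩ ⟨b, rfl⟩
        exact ⟨a + b, (smul_add _ _ _).symm⟩
      zero_mem' := ⟨0, (smul_zero _).symm⟩
      smul_mem' := by
        rintro a _ ⟨y, rfl⟩
        refine ⟨σ.symm a • y, ?_⟩
        rw [smul_smul, smul_smul, hσ]
        simp }
  have hkill : ∀ (a a' : A), π a = π a' → ∀ x : M ⧸ S, a • x = a' • x := by
    intro a a' h x
    obtain ⟨m, rfl⟩ := Submodule.mkQ_surjective S x
    have : π (a - a') = 0 := by rw [map_sub, h, sub_self]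
    obtain ⟨c, hc⟩ := (hker _).1 this
    rw [← sub_eq_zero, ← sub_smul, hc, mul_smul, ← map_smul]
    have : S.mkQ (ω • m) = 0 := by
      rw [Submodule.mkQ_apply, Submodule.Quotient.mk_eq_zero]
      exact ⟨m, rfl⟩
    rw [this, smul_zero]
  have hr := Function.surjInv_eq hπ
  letI : Module B (M ⧸ S) :=
    { smul := fun b x => Function.surjInv hπ b • x
      one_smul := fun x => by
        refine (hkill _ 1 ?_ x).trans (one_smul _ _)
        rw [hr, map_one]
      mul_smul := fun b b' x => by
        refine (hkill _ (Function.surjInv hπ b * Function.surjInv hπ b') ?_ x).trans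
          (mul_smul _ _ _)
        rw [map_mul, hr, hr, hr]
      smul_zero := fun b => smul_zero (Function.surjInv hπ b)
      smul_add := fun b => smul_add (Function.surjInv hπ b)
      add_smul := fun b b' x => by
        refine (hkill _ (Function.surjInv hπ b + Function.surjInv hπ b') ?_ x).trans
          (add_smul _ _ _)
        rw [map_add, hr, hr, hr]
      zero_smul := fun x => by
        refine (hkill _ 0 ?_ x).trans (zero_smul _ _)
        rw [hr, map_zero] }
  refine ⟨ModuleCat.of B (M ⧸ S),
    { toFun := fun m => S.mkQ m
      map_add' := fun x y => map_add _ _ _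
      map_smul' := fun a x => ?_ }, ?_, ?_⟩
  · rw [map_smul]
    exact hkill _ _ (hr _).symm _
  · exact Submodule.mkQ_surjective S
  · intro x
    exact Submodule.Quotient.mk_eq_zero S

lemma descend {A : Type*} [Ring A] {ω : A}
    {B : Type*} [Ring B] (π : A →+* B) (hπ : Function.Surjective π) (hω : π ω = 0)
    {M Mb L : Type*} [AddCommGroup M] [Module A M] [AddCommGroup Mb] [Module B Mb]
    [AddCommGroup L] [Module B L]
    (q : M →ₛₗ[π] Mb) (hq : Function.Surjective q)
    (hq0 : ∀ x, q x = 0 ↔ ∃ y, x = ω • y) (f : M →ₛₗ[π] L) :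
    ∃ fb : Mb →ₗ[B] L, ∀ x, fb (q x) = f x := by
  have key : ∀ x y, q x = q y → f x = f y := by
    intro x y h
    obtain ⟨z, hz⟩ := (hq0 (x - y)).1 (by rw [map_sub, h, sub_self])
    rw [← sub_eq_zero, ← map_sub, hz, map_smulₛₗ, hω, zero_smul]
  have hr := Function.surjInv_eq hq
  refine ⟨{ toFun := fun m => f (Function.surjInv hq m)
            map_add' := fun x y => ?_
            map_smul' := fun b x => ?_ }, fun x => key _ _ (hr _)⟩
  · rw [← map_add]
    apply key
    rw [map_add, hr, hr, hr]
  · obtain ⟨a, rfl⟩ := hπ b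
    simp only [RingHom.id_apply]
    rw [← map_smulₛₗ]
    apply key
    rw [map_smulₛₗ, hr, hr]

lemma semilift {A : Type*} [Ring A] {B : Type*} [Ring B] (π : A →+* B)
    {P F E : Type*} [AddCommGroup P] [Module A P] (hP : Module.Projective A P)
    [AddCommGroup F] [Module A F] [AddCommGroup E] [Module B E]
    (W : F →ₛₗ[π] E) (hW : Function.Surjective W) (f : P →ₛₗ[π] E) :
    ∃ G : P →ₗ[A] F, ∀ x, W (G x) = f x := by
  obtain ⟨s, hs⟩ := hP.out
  choose w hw using fun x => hW (f x)
  refine ⟨(Finsupp.linearCombination A w).comp s, fun x => ?_⟩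
  conv_rhs => rw [← hs x]
  rw [LinearMap.comp_apply, Finsupp.linearCombination_apply, Finsupp.linearCombination_apply,
    map_finsuppSum, map_finsuppSum]
  simp [map_smulₛₗ, hw]

/-- coefficientwise reduction -/
noncomputable def mapRed {A : Type*} [Ring A] {B : Type*} [Ring B] (π : A →+* B) (Q : Type*) :
    (Q →₀ A) →ₛₗ[π] (Q →₀ B) where
  toFun := fun f => f.mapRange π (map_zero π)
  map_add' := fun f g => by ext; simp
  map_smul' := fun a f => by ext; simp

lemma mapRed_apply {A : Type*} [Ring A] {B : Type*} [Ring B] (π : A →+* B) (Q : Type*)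
    (f : Q →₀ A) (i : Q) : mapRed π Q f i = π (f i) := rfl

lemma mapRed_surj {A : Type*} [Ring A] {B : Type*} [Ring B] (π : A →+* B)
    (hπ : Function.Surjective π) (Q : Type*) : Function.Surjective (mapRed π Q) :=
  Finsupp.mapRange_surjective π (map_zero π) hπ

lemma mapRed_ker {A : Type*} [Ring A] (ω : A) (σ : A ≃+* A)
    (hσ : ∀ a : A, ω * a = σ a * ω)
    {B : Type*} [Ring B] (π : A →+* B)
    (hker : ∀ x : A, π x = 0 ↔ ∃ a : A, x = a * ω) (Q : Type*) (f : Q →₀ A)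
    (hf : mapRed π Q f = 0) : ∃ g : Q →₀ A, f = ω • g := by
  have : ∀ a : A, ∃ b : A, (a = 0 → b = 0) ∧ (π a = 0 → a = ω * b) := by
    intro a
    by_cases h : a = 0
    · exact ⟨0, fun _ => rfl, fun _ => by simp [h]⟩
    · by_cases h' : π a = 0
      · obtain ⟨c, hc⟩ := (hker a).1 h'
        refine ⟨σ.symm c, fun h'' => absurd h'' h, fun _ => ?_⟩
        rw [hσ, hc]; simp
      · exact ⟨0, fun _ => rfl, fun h'' => absurd h'' h'⟩
  choose ψ h0 h1 using this
  refine ⟨f.mapRange ψ (h0 0 rfl), ?_⟩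
  ext i
  simp only [Finsupp.smul_apply, Finsupp.mapRange_apply, smul_eq_mul]
  apply h1
  have := congrArg (fun g => g i) hf
  simpa [mapRed_apply] using this

lemma red_projective {A : Type*} [Ring A] {ω : A}
    {B : Type*} [Ring B] (π : A →+* B) (hπ : Function.Surjective π) (hω : π ω = 0)
    {M Mb : Type*} [AddCommGroup M] [Module A M] [AddCommGroup Mb] [Module B Mb]
    (hP : Module.Projective A M)
    (q : M →ₛₗ[π] Mb) (hq : Function.Surjective q)
    (hq0 : ∀ x, q x = 0 ↔ ∃ y, x = ω • y) : Module.Projective B Mb := by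
  obtain ⟨s, hs⟩ := hP.out
  obtain ⟨fb, hfb⟩ := descend π hπ hω q hq hq0 ((mapRed π M).comp s)
  refine Module.Projective.of_split fb (Finsupp.linearCombination B q) ?_
  ext y
  obtain ⟨x, rfl⟩ := hq y
  rw [LinearMap.comp_apply, hfb, LinearMap.id_apply]
  conv_rhs => rw [← hs x]
  rw [LinearMap.comp_apply, Finsupp.linearCombination_apply, Finsupp.linearCombination_apply,
    map_finsuppSum]
  change (Finsupp.mapRange π (map_zero π) (s x)).sum _ = _
  rw [Finsupp.sum_mapRange_index (by simp)]
  simp [map_smulₛₗ]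

lemma red_hom {A : Type*} [Ring A] (ω : A) (σ : A ≃+* A)
    (hσ : ∀ a : A, ω * a = σ a * ω) (hreg' : ∀ a : A, ω * a = 0 → a = 0)
    {B : Type*} [Ring B] (π : A →+* B) (hπ : Function.Surjective π)
    (hker : ∀ x : A, π x = 0 ↔ ∃ a : A, x = a * ω) (hω : π ω = 0)
    {M0 M1 M2 N0 N1 N2 Q : Type*} [AddCommGroup M0] [Module A M0] [AddCommGroup M1] [Module A M1]
    [AddCommGroup M2] [Module A M2] [AddCommGroup N0] [Module B N0] [AddCommGroup N1]
    [Module B N1] [AddCommGroup N2] [Module B N2] [AddCommGroup Q] [Module B Q]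
    (hQ : Module.Projective B Q)
    (q0 : M0 →ₛₗ[π] N0) (q1 : M1 →ₛₗ[π] N1) (q2 : M2 →ₛₗ[π] N2)
    (hq1 : Function.Surjective q1) (hq2 : Function.Surjective q2)
    (hq20 : ∀ x, q2 x = 0 ↔ ∃ y, x = ω • y)
    (hP1 : Module.Projective A M1)
    (d0 : M0 →ₗ[A] M1) (d1 : M1 →ₗ[A] M2) (b0 : N0 →ₗ[B] N1) (b1 : N1 →ₗ[B] N2)
    (hb0 : ∀ x, b0 (q0 x) = q1 (d0 x)) (hb1 : ∀ x, b1 (q1 x) = q2 (d1 x))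
    (e : M2 ≃+ M0) (he : ∀ (a : A) (x : M2), e (a • x) = σ a • e x)
    (hde : ∀ y, d0 (e (d1 y)) = ω • y)
    (g : N1 →ₗ[B] Q) (hg : g ∘ₗ b0 = 0) : ∃ h : N2 →ₗ[B] Q, h ∘ₗ b1 = g := by
  obtain ⟨s, hs⟩ := hQ.out
  obtain ⟨G, hG⟩ := semilift π hP1 (mapRed π Q) (mapRed_surj π hπ Q) ((s ∘ₗ g).comp q1)
  have hK : ∀ x, ∃ k : Q →₀ A, G (d0 x) = ω • k := by
    intro x
    apply mapRed_ker ω σ hσ π hker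
    rw [hG, LinearMap.comp_apply, ← hb0, LinearMap.comp_apply]
    have : g (b0 (q0 x)) = 0 := by rw [← LinearMap.comp_apply, hg]; rfl
    rw [this, map_zero]
  choose K hK using hK
  have inj : ∀ f f' : Q →₀ A, ω • f = ω • f' → f = f' := by
    intro f f' h
    rw [← sub_eq_zero] at h ⊢
    rw [← smul_sub] at h
    exact omega_inj hreg' inferInstance _ h
  let H : M2 →ₗ[A] (Q →₀ A) :=
    { toFun := fun z => K (e z)
      map_add' := fun x y => by
        apply inj
        rw [← hK, smul_add, ← hK, ← hK]; simp
      map_smul' := fun a x => by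
        apply inj
        rw [← hK, he, map_smul, map_smul, hK, smul_smul, RingHom.id_apply, smul_smul, hσ] }
  have hH : ∀ y, H (d1 y) = G y := by
    intro y
    apply inj
    change ω • K (e (d1 y)) = _
    rw [← hK, hde, map_smul]
  obtain ⟨hb, hhb⟩ := descend π hπ hω q2 hq2 hq20
    ((Finsupp.linearCombination B (id : Q → Q)).comp ((mapRed π Q).comp H))
  refine ⟨hb, ?_⟩
  ext n
  obtain ⟨y, rfl⟩ := hq1 n
  rw [LinearMap.comp_apply, hb1, hhb, LinearMap.comp_apply, LinearMap.comp_apply, hH, hG]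
  exact hs _

lemma abstract_reflexive {A : Type u} [Ring A] (ω : A) (σ : A ≃+* A)
    (hσ : ∀ a : A, ω * a = σ a * ω) (hσω : σ ω = ω) (hreg' : ∀ a : A, ω * a = 0 → a = 0)
    {B : Type u} [Ring B] (π : A →+* B) (hπ : Function.Surjective π)
    (hker : ∀ x : A, π x = 0 ↔ ∃ a : A, x = a * ω)
    (M : ℤ → ModuleCat.{v} A) (d : ∀ i, M i →ₗ[A] M (i + 1))
    (e : ∀ i, M (i + 1 + 1) ≃+ M i)
    (he : ∀ i (a : A) (x : M (i + 1 + 1)), e i (a • x) = σ a • e i x)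
    (hed : ∀ i x, e i (d (i + 1) (d i x)) = ω • x)
    (hde : ∀ i y, d i (e i (d (i + 1) y)) = ω • y)
    (hP : ∀ i, Module.Projective A (M i)) (hF : ∀ i, Module.Finite A (M i))
    {N : Type v} [AddCommGroup N] [Module A N] [Module B N]
    (hcompat : ∀ (x : A) (n : N), x • n = π x • n)
    (j : ℤ) (hj : j + 1 + 1 = 0)
    (c : M (j + 1) →ₗ[A] N) (hc : Function.Surjective c)
    (hkerc : ∀ y, c y = 0 ↔ ∃ x, d j x = y) : IsTotallyReflexive B N := by
  have hω : π ω = 0 := (hker ω).2 ⟨1, (one_mul _).symm⟩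
  choose Mb q hq hq0 using fun i => exists_red ω σ hσ π hπ hker (M i)
  choose db hdb using fun i =>
    descend π hπ hω (q i) (hq i) (hq0 i) ((q (i + 1)).comp (d i))
  simp only [LinearMap.comp_apply] at hdb
  have hdd : ∀ i z, d (i + 1) (d i (e i z)) = ω • z := by
    intro i z
    apply (e i).injective
    rw [hed, he, hσω]
  have dinj : ∀ i y, d (i + 1) y = 0 → y = 0 := by
    intro i y h
    apply omega_inj hreg' (hP _)
    rw [← hde i y, h, map_zero, map_zero]
  have hex : ∀ i y, q (i + 1 + 1) (d (i + 1) y) = 0 → ∃ x, d i x = y := by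
    intro i y h
    obtain ⟨z, hz⟩ := (hq0 _ _).1 h
    refine ⟨e i z, ?_⟩
    rw [← sub_eq_zero]
    apply dinj i
    rw [map_sub, hdd, hz, sub_self]
  have hqdd : ∀ i x, q (i + 1 + 1) (d (i + 1) (d i x)) = 0 := by
    intro i x
    refine (hq0 _ _).2 ⟨(e i).symm x, ?_⟩
    rw [← hdd]; simp
  have hexact : ∀ i, LinearMap.range (db i) = LinearMap.ker (db (i + 1)) := by
    intro i
    ext n
    obtain ⟨y, rfl⟩ := hq _ n
    rw [LinearMap.mem_ker, hdb, LinearMap.mem_range]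
    constructor
    · rintro ⟨m, hm⟩
      obtain ⟨x, rfl⟩ := hq _ m
      rw [← hdb, ← hm, hdb, hdb, hqdd]
    · intro h
      obtain ⟨x, rfl⟩ := hex i y h
      exact ⟨q i x, hdb _ _⟩
  refine ⟨⟨Mb, db⟩, ⟨fun i => red_projective π hπ hω (hP i) (q i) (hq i) (hq0 i), hexact, ?_⟩,
    fun i => ?_, ?_⟩
  · intro Q _ _ hQ i g hg
    exact red_hom ω σ hσ hreg' π hπ hker hω hQ (q i) (q (i + 1)) (q (i + 1 + 1)) (hq _) (hq _)
      (hq0 _) (hP _) (d i) (d (i + 1)) (db i) (db (i + 1)) (hdb _) (hdb _) (e i) (he i) (hde i)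
      g hg
  · haveI : RingHomSurjective π := ⟨hπ⟩
    haveI := hF i
    exact Module.Finite.of_surjective (q i) (hq i)
  · change Nonempty (N ≃ₗ[B] LinearMap.ker (db 0))
    suffices ∀ m, m = j + 1 + 1 → Nonempty (N ≃ₗ[B] LinearMap.ker (db m)) from this 0 hj.symm
    rintro m rfl
    let c' : M (j + 1) →ₛₗ[π] N :=
      { toFun := c
        map_add' := map_add c
        map_smul' := fun a x => by rw [map_smul, hcompat] }
    obtain ⟨cb, hcb⟩ := descend π hπ hω (q (j + 1)) (hq _) (hq0 _) c'
    have hcb' : ∀ y, cb (q (j + 1) y) = c y := hcb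
    have hsurj : Function.Surjective cb := by
      intro n
      obtain ⟨y, rfl⟩ := hc n
      exact ⟨_, hcb' y⟩
    have hk : LinearMap.ker cb = LinearMap.ker (db (j + 1)) := by
      ext n
      obtain ⟨y, rfl⟩ := hq _ n
      rw [LinearMap.mem_ker, LinearMap.mem_ker, hcb', hkerc, hdb]
      constructor
      · rintro ⟨x, rfl⟩
        exact hqdd _ _
      · exact hex j y
    exact ⟨(cb.quotKerEquivOfSurjective hsurj).symm ≪≫ₗ Submodule.quotEquivOfEq _ _ hk ≪≫ₗ
      (db (j + 1)).quotKerEquivRange ≪≫ₗ LinearEquiv.ofEq _ _ (hexact (j + 1))⟩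

/-- The two components of a factorization, indexed by parity. -/
def mfY (X : MFact.{u, v} A ω σ) : Bool → ModuleCat.{v} A
  | false => X.X0
  | true => X.X1

/-- The two differentials, indexed by parity. -/
def mfD (X : MFact.{u, v} A ω σ) : ∀ b b' : Bool, b' = !b → (mfY ω σ X b →+ mfY ω σ X b')
  | false, true, _ => X.d0.toAddMonoidHom
  | true, false, _ => X.d1.toAddMonoidHom
  | true, true, h => absurd h (by decide)
  | false, false, h => absurd h (by decide)

/-- Transport along equality of parities. -/
def mfE (X : MFact.{u, v} A ω σ) : ∀ b b' : Bool, b' = b → (mfY ω σ X b' ≃+ mfY ω σ X b)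
  | _, _, rfl => AddEquiv.refl _

lemma mfD_smul (X : MFact.{u, v} A ω σ) (b b' : Bool) (h : b' = !b) (a : A) (x : mfY ω σ X b) :
    mfD ω σ X b b' h (a • x) = (if b then σ else 1 : RingAut A) a • mfD ω σ X b b' h x := by
  subst h
  cases b
  · exact X.d0.map_smul a x
  · exact X.d1.map_smulₛₗ a x

lemma mfE_smul (X : MFact.{u, v} A ω σ) (b b' : Bool) (h : b' = b) (a : A) (x : mfY ω σ X b') :
    mfE ω σ X b b' h (a • x) = a • mfE ω σ X b b' h x := by
  subst h; rfl

lemma mfED (X : MFact.{u, v} A ω σ) (b b' b'' : Bool) (h : b' = !b) (h' : b'' = !b')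
    (h'' : b'' = b) (x : mfY ω σ X b) :
    mfE ω σ X b b'' h'' (mfD ω σ X b' b'' h' (mfD ω σ X b b' h x)) = ω • x := by
  subst h''; subst h
  cases b''
  · exact X.comp01 x
  · exact X.comp10 x

lemma mfDE (X : MFact.{u, v} A ω σ) (b b' b'' : Bool) (h : b' = !b) (h' : b'' = !b')
    (h'' : b'' = b) (y : mfY ω σ X b') :
    mfD ω σ X b b' h (mfE ω σ X b b'' h'' (mfD ω σ X b' b'' h' y)) = ω • y := by
  subst h''; subst h
  cases b''
  · exact X.comp10 y
  · exact X.comp01 y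

lemma mfC (X : MFact.{u, v} A ω σ) {N : Type v} [AddCommGroup N] [Module A N]
    (c : X.X1 →ₗ[A] N) (hc : Function.Surjective c)
    (hkerc : LinearMap.ker c = LinearMap.range X.d0) (b b' : Bool) (h : b' = !b)
    (hb : b' = true) : ∃ c' : mfY ω σ X b' →ₗ[A] N, Function.Surjective c' ∧
      ∀ y, c' y = 0 ↔ ∃ x, mfD ω σ X b b' h x = y := by
  subst hb
  cases b
  · refine ⟨c, hc, fun y => ?_⟩
    change c y = 0 ↔ y ∈ LinearMap.range X.d0
    rw [← hkerc]; rfl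
  · cases h

/-- twist of a module along an automorphism. -/
def tw (M : ModuleCat.{v} A) (s : RingAut A) : ModuleCat.{v} A :=
  letI := Module.compHom M (s : A →+* A)
  ModuleCat.of A M

/-- identity map onto the twist -/
def toTw (M : ModuleCat.{v} A) (s : RingAut A) : M ≃+ tw M s := AddEquiv.refl _

lemma tw_smul (M : ModuleCat.{v} A) (s : RingAut A) (a : A) (x : M) :
    a • toTw M s x = toTw M s (s a • x) := rfl

lemma toTw_symm_smul (M : ModuleCat.{v} A) (s : RingAut A) (a : A) (x : tw M s) :
    (toTw M s).symm (a • x) = s a • (toTw M s).symm x := rfl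

/-- semilinear version -/
def toTwₛ (M : ModuleCat.{v} A) (s : RingAut A) :
    M →ₛₗ[((s.symm : A ≃+* A) : A →+* A)] tw M s where
  toFun := toTw M s
  map_add' := map_add _
  map_smul' := fun a x => by
    rw [tw_smul]
    congr 1
    simp

lemma tw_finite (M : ModuleCat.{v} A) (s : RingAut A) (h : Module.Finite A M) :
    Module.Finite A (tw M s) :=
  haveI : RingHomSurjective ((s.symm : A ≃+* A) : A →+* A) := ⟨s.symm.surjective⟩
  Module.Finite.of_surjective (toTwₛ M s) (toTw M s).surjective

lemma tw_projective (M : ModuleCat.{v} A) (s : RingAut A) (h : Module.Projective A M) :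
    Module.Projective A (tw M s) := by
  refine red_projective (ω := (0 : A)) ((s.symm : A ≃+* A) : A →+* A) s.symm.surjective
    (map_zero _) h (toTwₛ M s) (toTw M s).surjective ?_
  intro x
  simp only [zero_smul, exists_const]
  exact (toTw M s).map_eq_zero_iff

lemma mf_reflexive
    (hσ : ∀ a : A, ω * a = σ a * ω)
    (hreg : ∀ a : A, a * ω = 0 → a = 0) (hreg' : ∀ a : A, ω * a = 0 → a = 0)
    {B : Type u} [Ring B] (π : A →+* B) (hπ : Function.Surjective π)
    (hker : ∀ x : A, π x = 0 ↔ ∃ a : A, x = a * ω)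
    (X : MFact.{u, v} A ω σ)
    (hP0 : Module.Projective A X.X0) (hF0 : Module.Finite A X.X0)
    (hP1 : Module.Projective A X.X1) (hF1 : Module.Finite A X.X1)
    {N : Type v} [AddCommGroup N] [Module A N] [Module B N]
    (hcompat : ∀ (x : A) (n : N), x • n = π x • n)
    (c : X.X1 →ₗ[A] N) (hc : Function.Surjective c)
    (hkerc : LinearMap.ker c = LinearMap.range X.d0) : IsTotallyReflexive B N := by
  have hσω : σ ω = ω := by
    rw [← sub_eq_zero]
    apply hreg
    rw [sub_mul, ← hσ, sub_self]
  let par : ℤ → Bool := fun i => decide (i % 2 = 1)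
  let s : ℤ → RingAut A := fun i => (show RingAut A from σ) ^ (i / 2 + 1)
  have hpar : ∀ i, par (i + 1) = !par i := by
    intro i
    simp only [par]
    by_cases h : i % 2 = 1
    · have : ¬ (i + 1) % 2 = 1 := by omega
      simp [h, this]
    · have : (i + 1) % 2 = 1 := by omega
      simp [h, this]
  have hpar2 : ∀ i, par (i + 1 + 1) = par i := by
    intro i; rw [hpar, hpar]; simp
  have hs : ∀ i a, s (i + 1) a = (if par i then σ else 1 : RingAut A) (s i a) := by
    intro i a
    simp only [par, s]
    by_cases h : i % 2 = 1
    · have : (i + 1) / 2 + 1 = 1 + (i / 2 + 1) := by omega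
      rw [this, zpow_add, zpow_one]
      simp [h]
    · have : (i + 1) / 2 + 1 = (i / 2 + 1) := by omega
      rw [this]
      simp [h]
  have hs2 : ∀ i a, s (i + 1 + 1) a = s i (σ a) := by
    intro i a
    simp only [s]
    have : (i + 1 + 1) / 2 + 1 = (i / 2 + 1) + 1 := by omega
    rw [this, zpow_add_one]; rfl
  have hsω : ∀ i, s i ω = ω := by
    intro i
    have : σ ∈ MulAction.stabilizer (RingAut A) ω := hσω
    exact Subgroup.zpow_mem _ this (i / 2 + 1)
  obtain ⟨c', hc', hkc'⟩ := mfC ω σ X c hc hkerc (par (-2)) (par (-2 + 1)) (hpar _) (by decide)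
  have hs1 : ∀ a, s (-2 + 1) a = a := by
    intro a
    have : s (-2 + 1) = 1 := by
      simp [s]
    rw [this]; rfl
  have hYP : ∀ b, Module.Projective A (mfY ω σ X b) := by
    rintro (_ | _)
    · exact hP0
    · exact hP1
  have hYF : ∀ b, Module.Finite A (mfY ω σ X b) := by
    rintro (_ | _)
    · exact hF0
    · exact hF1
  refine abstract_reflexive ω σ hσ hσω hreg' π hπ hker (fun i => tw (mfY ω σ X (par i)) (s i))
    (fun i =>
      { toFun := fun x => toTw _ _ (mfD ω σ X (par i) (par (i + 1)) (hpar i) ((toTw _ _).symm x))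
        map_add' := fun x y => by simp
        map_smul' := fun a x => ?_ })
    (fun i => ((toTw _ _).symm.trans (mfE ω σ X (par i) (par (i + 1 + 1)) (hpar2 i))).trans
      (toTw _ _)) ?_ ?_ ?_ ?_ ?_ hcompat (-2) (by norm_num)
    { toFun := fun x => c' ((toTw _ _).symm x)
      map_add' := fun x y => by simp
      map_smul' := fun a x => ?_ } ?_ ?_
  · rw [toTw_symm_smul, mfD_smul, RingHom.id_apply, tw_smul, hs]
  · intro i a x
    simp only [AddEquiv.trans_apply]
    rw [toTw_symm_smul, mfE_smul, tw_smul, hs2]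
  · intro i x
    simp only [AddEquiv.trans_apply, LinearMap.coe_mk, AddHom.coe_mk, AddEquiv.symm_apply_apply]
    rw [mfED]
    conv_rhs => rw [← (toTw _ _).apply_symm_apply x]
    rw [tw_smul, hsω]
  · intro i x
    simp only [AddEquiv.trans_apply, LinearMap.coe_mk, AddHom.coe_mk, AddEquiv.symm_apply_apply]
    rw [mfDE]
    conv_rhs => rw [← (toTw _ _).apply_symm_apply x]
    rw [tw_smul, hsω]
  · intro i
    exact tw_projective _ _ (hYP _)
  · intro i
    exact tw_finite _ _ (hYF _)
  · rw [toTw_symm_smul, hs1, map_smul, RingHom.id_apply]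
  · exact hc'
  · intro y
    exact hkc' y

end Helpers

theorem matrix_factorization_cokernel_totally_reflexive
    {A : Type u} [Ring A] (ω : A) (σ : A ≃+* A)
    (hσ : ∀ a : A, ω * a = σ a * ω)
    (hreg : ∀ a : A, a * ω = 0 → a = 0) (hreg' : ∀ a : A, ω * a = 0 → a = 0)
    {B : Type u} [Ring B] (π : A →+* B) (hπ : Function.Surjective π)
    (hker : ∀ x : A, π x = 0 ↔ ∃ a : A, x = a * ω)
    (X : MFact.{u, v} A ω σ)
    (hP0 : Module.Projective A X.X0) (hF0 : Module.Finite A X.X0)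
    (hP1 : Module.Projective A X.X1) (hF1 : Module.Finite A X.X1)
    {N : Type v} [AddCommGroup N] [Module A N] [Module B N]
    (hcompat : ∀ (x : A) (n : N), x • n = π x • n)
    (c : X.X1 →ₗ[A] N) (hc : Function.Surjective c)
    (hkerc : LinearMap.ker c = LinearMap.range X.d0) :
    -- exactness of the reduced `2`-periodic complex, and `coker d⁰ ≅ ker(ᵗX̄⁰ → ᵗX̄¹)`
    (∀ x1 : X.X1, (∃ x0 : X.X0, X.d1 x1 = ω • x0) → ∃ x0 : X.X0, x1 = X.d0 x0) ∧
    (∀ x0 : X.X0, (∃ x1 : X.X1, X.d0 x0 = ω • x1) →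
      ∃ (x1 : X.X1) (z0 : X.X0), x0 = X.d1 x1 + ω • z0) ∧
    -- `Cok⁰(X)` is a totally reflexive `Ā`-module
    IsTotallyReflexive B N ∧
    -- of projective dimension at most `1` over `A`
    PdLE A 1 (ModuleCat.of A N) := by
  have dinj0 : ∀ x, X.d0 x = 0 → x = 0 := fun x h =>
    omega_inj hreg' hP0 x (by rw [← X.comp01, h, map_zero])
  have dinj1 : ∀ x, X.d1 x = 0 → x = 0 := fun x h =>
    omega_inj hreg' hP1 x (by rw [← X.comp10, h, map_zero])
  refine ⟨?_, ?_, mf_reflexive ω σ hσ hreg hreg' π hπ hker X hP0 hF0 hP1 hF1 hcompat c hc hkerc,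
    ?_⟩
  · rintro x1 ⟨x0, h⟩
    refine ⟨x0, ?_⟩
    rw [← sub_eq_zero]
    apply dinj1
    rw [map_sub, h, X.comp01, sub_self]
  · rintro x0 ⟨x1, h⟩
    refine ⟨x1, 0, ?_⟩
    rw [smul_zero, add_zero, ← sub_eq_zero]
    apply dinj0
    rw [map_sub, h, X.comp10, sub_self]
  · refine ⟨X.X1, c, hP1, hc, ?_⟩
    change Module.Projective A (LinearMap.ker c)
    have hinj : Function.Injective X.d0 := (injective_iff_map_eq_zero X.d0).2 dinj0
    exact Module.Projective.of_equiv
      (LinearEquiv.ofInjective X.d0 hinj ≪≫ₗ LinearEquiv.ofEq _ _ hkerc.symm)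
end
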